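/- arXiv:2308.13277 — 2 statements merged into one kernel-verified Lean document; each statement's English description precedes it below -/
import Mathlib

section
/- There is a universal constant c₀ > 0 with the following property. Let R be a register of qubits containing distinguished qubits A and B, H_else Hermitian on R, and P_A, P_B Pauli operators (Hermitian involutions) on qubits A and B. Let n ≥ 2, i ≠ j ∈ {1,…,n}, and Γ with Γλ + 1 > 5n. Define on R⊗(ℂ²)^{⊗n}: H₁ := H_else + (1/C)(d_i P_A² + d_j P_B²) and H₂ := (1/√C)(P_A⊗X_i − P_B⊗X_j), where d_k := ⟨W_n|X_k G X_k|W_n⟩ and C := ⟨W_n|X_i G X_j|W_n⟩ + ⟨W_n|X_j G X_i|W_n⟩. Then ‖H₁‖ ≤ ‖H_else‖ + 2n and ‖H₂‖ ≤ 2√n, and for all ε, η ∈ (0,1] and all Δ ≥ c₀(Λ⁶/ε² + Λ²/η²) with Λ := max(‖H₁‖, ‖H₂‖, 1), the Hamiltonian H̃ := Δ·(I_R⊗H_W) + H₁ + √Δ·H₂ is a (Δ/2, η, ε)-simulation of H_target := H_else + P_A⊗P_B with product encoding, with ancilla state |anc⟩ = |W_n⟩. -/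
open Matrix
open scoped Kronecker ComplexOrder

namespace QSim

/-- Index set for the computational basis of `n` qubits. -/
abbrev QIdx (n : ℕ) := Fin n → Fin 2

/-- Operators (matrices) on the Hilbert space of `n` qubits. -/
abbrev QOp (n : ℕ) := Matrix (QIdx n) (QIdx n) ℂ

/-- The operator (`ℓ²→ℓ²`) norm of a (possibly rectangular) matrix. -/
noncomputable def opNorm {I J : Type*} [Fintype I] [Fintype J] [DecidableEq J]
    (M : Matrix I J ℂ) : ℝ :=
  ‖LinearMap.toContinuousLinearMap (Matrix.toEuclideanLin M)‖

/-- A two-qubit operator `E` placed on qubits `i` and `j` of an `n`-qubit register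
(identity elsewhere), given entrywise. -/
def twoQubitOp (n : ℕ) (i j : Fin n) (E : Fin 2 → Fin 2 → Fin 2 → Fin 2 → ℂ) : QOp n :=
  fun x y => E (x i) (x j) (y i) (y j) * (if ∀ k, k ≠ i → k ≠ j → x k = y k then 1 else 0)

/-- A single-qubit operator `E` placed on qubit `i` of an `n`-qubit register. -/
def oneQubitOp (n : ℕ) (i : Fin n) (E : Matrix (Fin 2) (Fin 2) ℂ) : QOp n :=
  fun x y => E (x i) (y i) * (if ∀ k, k ≠ i → x k = y k then 1 else 0)

/-- Sign used to build `(|01⟩ - |10⟩)/√2`. -/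
def sgnE (a b : Fin 2) : ℂ :=
  if a = 0 ∧ b = 1 then 1 else if a = 1 ∧ b = 0 then -1 else 0

/-- Entries of the two-qubit projector `P` onto `span{(|01⟩-|10⟩)/√2, |11⟩}`:
`P = (1/2)(|01⟩-|10⟩)(⟨01|-⟨10|) + |11⟩⟨11|`. -/
noncomputable def Pentry (a b c d : Fin 2) : ℂ :=
  (1 / 2) * sgnE a b * sgnE c d + (if a = 1 ∧ b = 1 ∧ c = 1 ∧ d = 1 then 1 else 0)

/-- `H_{W,0} = Σ_{i=1}^{n-1} P_{i,i+1}`. -/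
noncomputable def HW0 (n : ℕ) : QOp n :=
  ∑ i : Fin (n - 1),
    twoQubitOp n ⟨i.1, by have := i.2; omega⟩ ⟨i.1 + 1, by have := i.2; omega⟩ Pentry

/-- The all-zeros state `|0…0⟩`. -/
def ket0 (n : ℕ) : QIdx n → ℂ := fun x => if ∀ k, x k = 0 then 1 else 0

/-- The generalized W state `|W_n⟩ = n^{-1/2} Σ_i |e_i⟩`. -/
noncomputable def Wstate (n : ℕ) : QIdx n → ℂ := fun x =>
  if (Finset.univ.filter fun k => x k = 1).card = 1 then (((Real.sqrt n)⁻¹ : ℝ) : ℂ) else 0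

end QSim

namespace QSim

/-- The Pauli `Z` matrix. -/
noncomputable def Zmat : Matrix (Fin 2) (Fin 2) ℂ := !![1, 0; 0, -1]

/-- The Pauli `X` matrix. -/
noncomputable def Xmat : Matrix (Fin 2) (Fin 2) ℂ := !![0, 1; 1, 0]

/-- The W-state parent Hamiltonian `H_W = Γ·H_{W,0} + 1 - Σ_{i=1}^n (1 - Z_i)/2`. -/
noncomputable def HWham (n : ℕ) (Γ : ℝ) : QOp n :=
  (Γ : ℂ) • HW0 n + 1 - ∑ i : Fin n, oneQubitOp n i ((1 - Zmat) / 2)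

end QSim

namespace QSim

/-- The rank-one projector `Π₋ = |W_n⟩⟨W_n|` (entries are real, so no conjugation is needed). -/
noncomputable def projW (n : ℕ) : QOp n := fun x y => Wstate n x * Wstate n y

/-- The Pauli `X` operator on qubit `i` of the chain. -/
noncomputable def Xop (n : ℕ) (i : Fin n) : QOp n := oneQubitOp n i Xmat

/-- The computational basis index with `1`s exactly in positions `a` and `i` (for `a ≠ i`),
i.e. the label of the basis state `|e_a ⊕ e_i⟩`. -/
def pairIdx (n : ℕ) (a i : Fin n) : QIdx n := fun k => if k = a ∨ k = i then 1 else 0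

/-- The expectation value `⟨W_n| M |W_n⟩`. -/
noncomputable def expectW (n : ℕ) (M : QOp n) : ℂ :=
  star (Wstate n) ⬝ᵥ (M *ᵥ Wstate n)

end QSim

namespace QSim

open scoped Classical in
/-- The spectral projector of a Hermitian matrix onto the span of its eigenvectors with
eigenvalue strictly below `Δ` (junk value `0` if the matrix is not Hermitian). -/
noncomputable def specProjBelow {I : Type*} [Fintype I] [DecidableEq I]
    (M : Matrix I I ℂ) (Δ : ℝ) : Matrix I I ℂ :=
  if hM : M.IsHermitian then
    (hM.eigenvectorUnitary : Matrix I I ℂ) *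
      Matrix.diagonal (fun k => if hM.eigenvalues k < Δ then (1 : ℂ) else 0) *
      (hM.eigenvectorUnitary : Matrix I I ℂ)ᴴ
  else 0

/-- The isometry `T : ψ ↦ ψ ⊗ |anc⟩` from `ℋ` into `ℋ⊗𝒜`, as a rectangular matrix. -/
def prodIso {I J : Type*} [DecidableEq I] (anc : J → ℂ) : Matrix (I × J) I ℂ :=
  fun p i => if p.1 = i then anc p.2 else 0

/-- `H_s` (on `ℋ⊗𝒜`) is a `(Δ,η,ε)`-simulation of `H_t` (on `ℋ`) with product encoding,
witnessed by the isometry `T̃`: `|anc⟩` is a unit vector, `T̃` is an isometry with range the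
eigenspace of `H_s` of energies `< Δ`, `‖T̃ - (·⊗|anc⟩)‖ ≤ η`, and
`‖P H_s P - T̃ H_t T̃†‖ ≤ ε` where `P` is the spectral projector below `Δ`. -/
noncomputable def IsSimulationWith {I J : Type*} [Fintype I] [DecidableEq I]
    [Fintype J] [DecidableEq J]
    (Hs : Matrix (I × J) (I × J) ℂ) (Ht : Matrix I I ℂ) (anc : J → ℂ)
    (Tt : Matrix (I × J) I ℂ) (Δ η ε : ℝ) : Prop :=
  star anc ⬝ᵥ anc = 1 ∧
  Ttᴴ * Tt = 1 ∧
  Tt * Ttᴴ = specProjBelow Hs Δ ∧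
  opNorm (Tt - prodIso anc) ≤ η ∧
  opNorm (specProjBelow Hs Δ * Hs * specProjBelow Hs Δ - Tt * Ht * Ttᴴ) ≤ ε

/-- `H_s` is a `(Δ,η,ε)`-simulation of `H_t` with product encoding (ancilla state `anc`). -/
noncomputable def IsSimulation {I J : Type*} [Fintype I] [DecidableEq I]
    [Fintype J] [DecidableEq J]
    (Hs : Matrix (I × J) (I × J) ℂ) (Ht : Matrix I I ℂ) (anc : J → ℂ) (Δ η ε : ℝ) : Prop :=
  ∃ Tt : Matrix (I × J) I ℂ, IsSimulationWith Hs Ht anc Tt Δ η ε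

end QSim

namespace QSim

open scoped Matrix.Norms.L2Operator

section Spectral

variable {I : Type*} [Fintype I] [DecidableEq I] {M : Matrix I I ℂ}

/-- The matrix with the eigenvectors of `M` and eigenvalues `d`. -/
noncomputable def specFn (hM : M.IsHermitian) (d : I → ℂ) : Matrix I I ℂ :=
  (hM.eigenvectorUnitary : Matrix I I ℂ) * diagonal d *
    (hM.eigenvectorUnitary : Matrix I I ℂ)ᴴ

lemma eigenvectorUnitary_conjTranspose_mul (hM : M.IsHermitian) :
    (hM.eigenvectorUnitary : Matrix I I ℂ)ᴴ * (hM.eigenvectorUnitary : Matrix I I ℂ) = 1 :=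
  Unitary.coe_star_mul_self hM.eigenvectorUnitary

lemma eigenvectorUnitary_mul_conjTranspose (hM : M.IsHermitian) :
    (hM.eigenvectorUnitary : Matrix I I ℂ) * (hM.eigenvectorUnitary : Matrix I I ℂ)ᴴ = 1 :=
  Unitary.coe_mul_star_self hM.eigenvectorUnitary

lemma specFn_mul (hM : M.IsHermitian) (d d' : I → ℂ) :
    specFn hM d * specFn hM d' = specFn hM (fun k => d k * d' k) := by
  unfold specFn
  rw [← diagonal_mul_diagonal]
  simp only [Matrix.mul_assoc]
  rw [← Matrix.mul_assoc _ᴴ _ (diagonal d' * _), eigenvectorUnitary_conjTranspose_mul,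
    Matrix.one_mul]

lemma specFn_eigenvalues (hM : M.IsHermitian) :
    specFn hM (fun k => (hM.eigenvalues k : ℂ)) = M :=
  hM.spectral_theorem.symm

lemma specFn_mul_right (hM : M.IsHermitian) (d : I → ℂ) :
    specFn hM d * M = specFn hM (fun k => d k * hM.eigenvalues k) := by
  rw [← specFn_mul, specFn_eigenvalues]

lemma specFn_one (hM : M.IsHermitian) : specFn hM (fun _ => 1) = 1 := by
  simp [specFn, diagonal_one, eigenvectorUnitary_mul_conjTranspose]

lemma specFn_add (hM : M.IsHermitian) (d d' : I → ℂ) :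
    specFn hM (fun k => d k + d' k) = specFn hM d + specFn hM d' := by
  simp only [specFn, ← Matrix.add_mul, ← Matrix.mul_add, diagonal_add]

lemma specFn_sub (hM : M.IsHermitian) (d d' : I → ℂ) :
    specFn hM (fun k => d k - d' k) = specFn hM d - specFn hM d' := by
  simp only [specFn, ← Matrix.sub_mul, ← Matrix.mul_sub, diagonal_sub]

lemma specFn_const_mul (hM : M.IsHermitian) (c : ℂ) (d : I → ℂ) :
    specFn hM (fun k => c * d k) = c • specFn hM d := by
  have h : diagonal (fun k => c * d k) = c • diagonal d := by
    rw [← diagonal_smul]; rfl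
  simp only [specFn, h, Matrix.mul_smul, Matrix.smul_mul]

lemma specFn_conjTranspose (hM : M.IsHermitian) (d : I → ℂ) :
    (specFn hM d)ᴴ = specFn hM (star d) := by
  simp [specFn, diagonal_conjTranspose, Matrix.mul_assoc]

lemma conj_specFn (hM : M.IsHermitian) (d : I → ℂ) :
    (hM.eigenvectorUnitary : Matrix I I ℂ)ᴴ * specFn hM d *
      (hM.eigenvectorUnitary : Matrix I I ℂ) = diagonal d := by
  unfold specFn
  simp only [Matrix.mul_assoc]
  rw [eigenvectorUnitary_conjTranspose_mul, ← Matrix.mul_assoc,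
    eigenvectorUnitary_conjTranspose_mul, Matrix.one_mul, Matrix.mul_one]

lemma norm_le_one_of_conjTranspose_mul_self {J K : Type*} [Fintype J] [DecidableEq J]
    [Fintype K] [DecidableEq K] {A : Matrix J K ℂ}
    (h : Aᴴ * A = 1) : ‖A‖ ≤ 1 := by
  have h1 := l2_opNorm_conjTranspose_mul_self A
  rw [h] at h1
  have h2 : ‖(1 : Matrix K K ℂ)‖ ≤ 1 := by
    rw [← diagonal_one, l2_opNorm_diagonal]
    exact (pi_norm_le_iff_of_nonneg zero_le_one).2 fun _ => by simp
  nlinarith [norm_nonneg A]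

lemma norm_one_le : ‖(1 : Matrix I I ℂ)‖ ≤ 1 :=
  norm_le_one_of_conjTranspose_mul_self (by simp)

lemma norm_specFn_le (hM : M.IsHermitian) {d : I → ℂ} {c : ℝ} (hc : 0 ≤ c)
    (hd : ∀ k, ‖d k‖ ≤ c) : ‖specFn hM d‖ ≤ c := by
  have hU := norm_le_one_of_conjTranspose_mul_self (eigenvectorUnitary_conjTranspose_mul hM)
  have hD : ‖(diagonal d : Matrix I I ℂ)‖ ≤ c := by
    rw [l2_opNorm_diagonal]
    exact (pi_norm_le_iff_of_nonneg hc).2 hd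
  calc ‖specFn hM d‖ ≤ 1 * c * 1 := by
        unfold specFn
        refine (l2_opNorm_mul _ _).trans ?_
        rw [l2_opNorm_conjTranspose]
        gcongr
        exact (l2_opNorm_mul _ _).trans (by gcongr)
    _ = c := by ring

lemma norm_apply_le_norm_specFn (hM : M.IsHermitian) (d : I → ℂ) (k : I) :
    ‖d k‖ ≤ ‖specFn hM d‖ := by
  have hU := norm_le_one_of_conjTranspose_mul_self (eigenvectorUnitary_conjTranspose_mul hM)
  calc ‖d k‖ ≤ ‖(diagonal d : Matrix I I ℂ)‖ := by
        rw [l2_opNorm_diagonal]; exact norm_le_pi_norm d k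
    _ ≤ 1 * ‖specFn hM d‖ * 1 := by
        rw [← conj_specFn hM d]
        refine (l2_opNorm_mul _ _).trans ?_
        gcongr
        refine (l2_opNorm_mul _ _).trans ?_
        rw [l2_opNorm_conjTranspose]
        gcongr
    _ = _ := by ring

lemma posSemidef_specFn_iff (hM : M.IsHermitian) (d : I → ℂ) :
    (specFn hM d).PosSemidef ↔ ∀ k, 0 ≤ d k := by
  constructor
  · intro h
    have h2 := h.conjTranspose_mul_mul_same (hM.eigenvectorUnitary : Matrix I I ℂ)
    rw [conj_specFn] at h2
    exact posSemidef_diagonal_iff.1 h2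
  · intro h
    exact (posSemidef_diagonal_iff.2 h).mul_mul_conjTranspose_same _

lemma posSemidef_add_norm (hM : M.IsHermitian) : (M + (‖M‖ : ℂ) • 1).PosSemidef := by
  have h : M + (‖M‖ : ℂ) • 1 = specFn hM (fun k => (hM.eigenvalues k : ℂ) + (‖M‖ : ℂ) * 1) := by
    rw [specFn_add, specFn_const_mul, specFn_one, specFn_eigenvalues]
  rw [h, posSemidef_specFn_iff]
  intro k
  have hk := norm_apply_le_norm_specFn hM (fun k => (hM.eigenvalues k : ℂ)) k
  rw [specFn_eigenvalues, Complex.norm_real, Real.norm_eq_abs] at hk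
  have := neg_abs_le (hM.eigenvalues k)
  rw [mul_one, ← Complex.ofReal_add, Complex.zero_le_real]
  linarith

lemma norm_le_inv_of_posSemidef (hM : M.IsHermitian) {c : ℝ} (hc : 0 < c)
    (h : (M - (c : ℂ) • (M * M)).PosSemidef) : ‖M‖ ≤ c⁻¹ := by
  have e : M - (c : ℂ) • (M * M) = specFn hM (fun k => (hM.eigenvalues k : ℂ) -
      c * ((hM.eigenvalues k : ℂ) * hM.eigenvalues k)) := by
    rw [specFn_sub, specFn_const_mul, ← specFn_mul, specFn_eigenvalues]
  rw [e, posSemidef_specFn_iff] at h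
  conv_lhs => rw [← specFn_eigenvalues hM]
  refine norm_specFn_le hM (by positivity) fun k => ?_
  have hk := h k
  norm_cast at hk
  rw [Complex.norm_real, Real.norm_eq_abs, abs_le, inv_eq_one_div]
  have h0 : 0 ≤ hM.eigenvalues k := by nlinarith [sq_nonneg (hM.eigenvalues k)]
  refine ⟨h0.trans' (by simp; positivity), ?_⟩
  rw [le_div_iff₀ hc]
  by_contra hlt
  nlinarith

/-- A matrix close to the identity has an inverse square root close to the identity. -/
lemma exists_inv_sqrt (hM : M.IsHermitian) {t : ℝ} (ht : ‖M - 1‖ ≤ t) (ht2 : t ≤ 1 / 2) :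
    ∃ S : Matrix I I ℂ, Sᴴ = S ∧ S * M * S = 1 ∧ S * S * M = 1 ∧ ‖S - 1‖ ≤ 2 * t := by
  have ht0 : 0 ≤ t := (norm_nonneg _).trans ht
  have hk : ∀ k, |hM.eigenvalues k - 1| ≤ t := by
    intro k
    have e : M - 1 = specFn hM (fun k => (hM.eigenvalues k : ℂ) - 1) := by
      rw [specFn_sub, specFn_one, specFn_eigenvalues]
    rw [e] at ht
    have := (norm_apply_le_norm_specFn hM (fun k => (hM.eigenvalues k : ℂ) - 1) k).trans ht
    rw [← Complex.ofReal_one, ← Complex.ofReal_sub, Complex.norm_real, Real.norm_eq_abs] at this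
    exact this
  have hpos : ∀ k, 0 < hM.eigenvalues k := fun k => by
    have := (abs_le.1 (hk k)).1; linarith
  set r : I → ℝ := fun k => (√(hM.eigenvalues k))⁻¹ with hr
  have hrr : ∀ k, r k * r k * hM.eigenvalues k = 1 := by
    intro k
    have h1 := Real.mul_self_sqrt (hpos k).le
    have h2 := Real.sqrt_pos.2 (hpos k)
    simp only [hr]
    nth_rewrite 3 [← h1]
    field_simp
  refine ⟨specFn hM (fun k => (r k : ℂ)), ?_, ?_, ?_, ?_⟩
  · rw [specFn_conjTranspose]; congr 1; ext k; simp
  · nth_rewrite 2 [← specFn_eigenvalues hM]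
    rw [specFn_mul, specFn_mul, ← specFn_one hM]
    congr 1; ext k
    have := hrr k
    norm_cast; linarith
  · nth_rewrite 3 [← specFn_eigenvalues hM]
    rw [specFn_mul, specFn_mul, ← specFn_one hM]
    congr 1; ext k
    have := hrr k
    norm_cast
  · rw [← specFn_one hM, ← specFn_sub]
    refine norm_specFn_le hM (by positivity) fun k => ?_
    rw [← Complex.ofReal_one, ← Complex.ofReal_sub, Complex.norm_real, Real.norm_eq_abs]
    have h0 : 0 < r k := inv_pos.2 (Real.sqrt_pos.2 (hpos k))
    have h1 := hrr k
    have h2 := abs_le.1 (hk k)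
    rw [abs_le]
    have h3 : r k * r k * (1 - t) ≤ 1 := by nlinarith [mul_pos h0 h0]
    have h4 : 1 ≤ r k * r k * (1 + t) := by nlinarith [mul_pos h0 h0]
    constructor
    · by_contra hlt
      nlinarith
    · by_contra hlt
      have : 1 + 2 * t < r k := by linarith
      have : (1 + 2 * t) * (1 + 2 * t) < r k * r k := by nlinarith
      nlinarith

end Spectral

end QSim

namespace QSim

open scoped Matrix.Norms.L2Operator

section Perturbation

variable {I F : Type*} [Fintype I] [DecidableEq I] [Fintype F] [DecidableEq F]

lemma norm_mul_le_of_le {J K L : Type*} [Fintype J] [DecidableEq J] [Fintype K] [DecidableEq K]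
    [Fintype L] [DecidableEq L] {A : Matrix J K ℂ} {B : Matrix K L ℂ} {a b : ℝ}
    (hA : ‖A‖ ≤ a) (hB : ‖B‖ ≤ b) : ‖A * B‖ ≤ a * b :=
  (l2_opNorm_mul A B).trans
    (mul_le_mul hA hB (norm_nonneg _) ((norm_nonneg _).trans hA))

lemma norm_le_one_of_isIdempotent {P : Matrix F F ℂ} (hP : Pᴴ = P) (hPP : P * P = P) :
    ‖P‖ ≤ 1 := by
  have h := l2_opNorm_conjTranspose_mul_self P
  rw [hP, hPP] at h
  nlinarith [norm_nonneg P]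

lemma specProjBelow_spec {M : Matrix F F ℂ} (hM : M.IsHermitian) {τ : ℝ} (hτ : 0 < τ)
    (hlow : (M + (τ : ℂ) • 1).PosSemidef) :
    (specProjBelow M τ)ᴴ = specProjBelow M τ ∧
    specProjBelow M τ * specProjBelow M τ = specProjBelow M τ ∧
    M * specProjBelow M τ = specProjBelow M τ * M ∧
    ‖M * specProjBelow M τ‖ ≤ τ ∧
    ∃ R : Matrix F F ℂ, R * M = 1 - specProjBelow M τ ∧ ‖R‖ ≤ τ⁻¹ := by
  classical
  have hP : specProjBelow M τ =
      specFn hM (fun k => if hM.eigenvalues k < τ then (1 : ℂ) else 0) := by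
    simp only [specProjBelow, dif_pos hM, specFn]
  have hlow' : ∀ k, -τ ≤ hM.eigenvalues k := by
    have e : M + (τ : ℂ) • 1 = specFn hM (fun k => (hM.eigenvalues k : ℂ) + (τ : ℂ) * 1) := by
      rw [specFn_add, specFn_const_mul, specFn_one, specFn_eigenvalues]
    rw [e, posSemidef_specFn_iff] at hlow
    intro k
    have := hlow k
    rw [mul_one, ← Complex.ofReal_add, Complex.zero_le_real] at this
    linarith
  have hMP : M * specProjBelow M τ = specFn hM
      (fun k => (hM.eigenvalues k : ℂ) * if hM.eigenvalues k < τ then (1 : ℂ) else 0) := by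
    rw [← specFn_mul, specFn_eigenvalues, hP]
  refine ⟨?_, ?_, ?_, ?_, specFn hM (fun k => if hM.eigenvalues k < τ then 0 else
    ((hM.eigenvalues k)⁻¹ : ℝ)), ?_, ?_⟩
  · rw [hP, specFn_conjTranspose]
    congr 1; ext k; simp only [Pi.star_apply]; split_ifs <;> simp
  · rw [hP, specFn_mul]
    congr 1; ext k; split_ifs <;> simp
  · rw [hMP, hP, specFn_mul_right]
    congr 1; ext k; ring
  · rw [hMP]
    refine norm_specFn_le hM hτ.le fun k => ?_
    split_ifs with h
    · rw [mul_one, Complex.norm_real, Real.norm_eq_abs, abs_le]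
      exact ⟨hlow' k, h.le⟩
    · simpa using hτ.le
  · rw [hP, ← specFn_one hM, ← specFn_sub, specFn_mul_right]
    congr 1; ext k
    split_ifs with h
    · simp
    · have : hM.eigenvalues k ≠ 0 := (hτ.trans_le (not_lt.1 h)).ne'
      push_cast
      rw [inv_mul_cancel₀ (by exact_mod_cast this)]; simp
  · refine norm_specFn_le hM (by positivity) fun k => ?_
    split_ifs with h
    · simpa using hτ.le
    · rw [Complex.norm_real, Real.norm_eq_abs, abs_inv]
      have h' := not_lt.1 h
      rw [abs_of_pos (hτ.trans_le h')]
      gcongr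

set_option maxHeartbeats 1000000 in
/-- Second-order perturbation theory: if `P` reduces `H = s² H₀ + H₁ + s H₂` and separates its
low energies from its high ones, then `P` is the range of an isometry close to `T`, and `H`
restricted to it is close to the second-order effective Hamiltonian. -/
lemma exists_isometry_of_reducing {T : Matrix F I ℂ} {H₀ G H₁ H₂ P R : Matrix F F ℂ}
    {h₁ : Matrix I I ℂ} {Λ s : ℝ} (hT : Tᴴ * T = 1) (hH₀ : H₀ᴴ = H₀)
    (hGH : G * H₀ = 1 - T * Tᴴ) (hGn : ‖G‖ ≤ 1) (hGT : G * T = 0) (hH₀T : H₀ * T = 0)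
    (hH₁ : H₁ᴴ = H₁) (hH₂ : H₂ᴴ = H₂) (h₁T : H₁ * T = T * h₁) (h₂T : Tᴴ * H₂ * T = 0)
    (hn₁ : ‖H₁‖ ≤ Λ) (hn₁' : ‖h₁‖ ≤ Λ) (hn₂ : ‖H₂‖ ≤ Λ) (hΛ : 1 ≤ Λ) (hs : 1000 * Λ ≤ s)
    {H : Matrix F F ℂ} (hH : H = ((s ^ 2 : ℝ) : ℂ) • H₀ + H₁ + (s : ℂ) • H₂)
    (hP : Pᴴ = P) (hPP : P * P = P) (hHP : H * P = P * H) (hHPn : ‖H * P‖ ≤ s ^ 2 / 2)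
    (hR : R * H = 1 - P) (hRn : ‖R‖ ≤ (s ^ 2 / 2)⁻¹) :
    ∃ Tt : Matrix F I ℂ, Ttᴴ * Tt = 1 ∧ Tt * Ttᴴ = P ∧ ‖Tt - T‖ ≤ 100 * Λ / s ∧
      ‖P * H * P - Tt * (h₁ - Tᴴ * (H₂ * G * H₂) * T) * Ttᴴ‖ ≤ 100 * Λ ^ 3 / s := by
  have hs0 : 0 < s := by linarith
  have hsC : (s : ℂ) ≠ 0 := by exact_mod_cast hs0.ne'
  set V : Matrix F F ℂ := H₁ + (s : ℂ) • H₂ with hV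
  have hHV : H = ((s ^ 2 : ℝ) : ℂ) • H₀ + V := by rw [hH, hV, add_assoc]
  have hVherm : Vᴴ = V := by
    rw [hV, conjTranspose_add, conjTranspose_smul, hH₁, hH₂]; simp
  have hHherm : Hᴴ = H := by
    rw [hHV, conjTranspose_add, conjTranspose_smul, hH₀, hVherm]; simp
  have hVn : ‖V‖ ≤ 2 * s * Λ := by
    have : ‖(s : ℂ) • H₂‖ ≤ s * Λ := by
      rw [norm_smul, Complex.norm_real, Real.norm_eq_abs, abs_of_pos hs0]
      gcongr
    calc ‖V‖ ≤ Λ + s * Λ := (norm_add_le _ _).trans (add_le_add hn₁ this)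
      _ ≤ _ := by nlinarith
  have hTn : ‖T‖ ≤ 1 := norm_le_one_of_conjTranspose_mul_self hT
  have hTn' : ‖Tᴴ‖ ≤ 1 := by rwa [l2_opNorm_conjTranspose]
  have hPn : ‖P‖ ≤ 1 := norm_le_one_of_isIdempotent hP hPP
  set δ : ℝ := 4 * Λ / s with hδ
  have hδ0 : 0 ≤ δ := by positivity
  have hδ1 : δ ≤ 1 / 250 := by
    rw [hδ, div_le_iff₀ hs0]; linarith
  have hHT : H * T = V * T := by
    rw [hHV, Matrix.add_mul, Matrix.smul_mul, hH₀T, smul_zero, zero_add]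
  -- the low-energy states of `H₀` are almost of low energy for `H`
  set X : Matrix F I ℂ := (1 - P) * T with hX
  have hXn : ‖X‖ ≤ δ := by
    have e : X = R * (V * T) := by rw [hX, ← hR, Matrix.mul_assoc, hHT]
    rw [e]
    refine (norm_mul_le_of_le hRn (norm_mul_le_of_le hVn hTn)).trans_eq ?_
    rw [hδ]; field_simp; ring
  -- and conversely
  set Z : Matrix F F ℂ := (1 - T * Tᴴ) * P with hZ
  have hGZ : G * Z = G * P := by
    rw [hZ, Matrix.sub_mul, Matrix.mul_sub, Matrix.one_mul, ← Matrix.mul_assoc,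
      ← Matrix.mul_assoc, hGT, Matrix.zero_mul, Matrix.zero_mul, sub_zero]
  have hPHP : P * (H * P) = H * P := by
    rw [hHP, ← Matrix.mul_assoc, hPP]
  have hZeq : ((s ^ 2 : ℝ) : ℂ) • Z = G * Z * (H * P) - G * V * P := by
    have e1 : G * Z * (H * P) = G * H * P := by
      rw [hGZ, Matrix.mul_assoc, hPHP, Matrix.mul_assoc]
    rw [e1, hHV, Matrix.mul_add, Matrix.add_mul, add_sub_cancel_right, Matrix.mul_smul,
      Matrix.smul_mul, hGH]
  have hZn : ‖Z‖ ≤ δ := by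
    have h1 : ‖((s ^ 2 : ℝ) : ℂ) • Z‖ ≤ 1 * ‖Z‖ * (s ^ 2 / 2) + 1 * (2 * s * Λ) * 1 := by
      rw [hZeq]
      exact (norm_sub_le _ _).trans (add_le_add
        (norm_mul_le_of_le (norm_mul_le_of_le hGn le_rfl) hHPn)
        (norm_mul_le_of_le (norm_mul_le_of_le hGn hVn) hPn))
    rw [norm_smul, Complex.norm_real, Real.norm_eq_abs, abs_of_pos (by positivity)] at h1
    rw [hδ, le_div_iff₀ hs0]
    have : s * (‖Z‖ * s) ≤ s * (4 * Λ) := by linarith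
    exact le_of_mul_le_mul_left this hs0
  set K : Matrix I I ℂ := Tᴴ * P * T with hK
  have hKherm : K.IsHermitian := by
    show Kᴴ = K
    rw [hK]; simp [hP, Matrix.mul_assoc]
  have hK1 : K - 1 = -(Xᴴ * X) := by
    rw [hK, hX, conjTranspose_mul, conjTranspose_sub, conjTranspose_one, hP,
      Matrix.mul_assoc Tᴴ (1 - P), ← Matrix.mul_assoc (1 - P) (1 - P)]
    have : (1 - P) * (1 - P) = 1 - P := by
      rw [Matrix.mul_sub, Matrix.mul_one, Matrix.sub_mul, Matrix.one_mul, hPP, sub_self,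
        sub_zero]
    rw [this, Matrix.sub_mul, Matrix.mul_sub, Matrix.one_mul, hT, neg_sub, Matrix.mul_assoc]
  have hKn : ‖K - 1‖ ≤ δ ^ 2 := by
    rw [hK1, norm_neg, l2_opNorm_conjTranspose_mul_self]
    nlinarith [norm_nonneg X]
  obtain ⟨S, hS, hSKS, hSSK, hSn⟩ := exists_inv_sqrt hKherm hKn (by nlinarith)
  have hSn2 : ‖S‖ ≤ 2 := by
    calc ‖S‖ = ‖(S - 1) + 1‖ := by rw [sub_add_cancel]
      _ ≤ 2 * δ ^ 2 + 1 := (norm_add_le _ _).trans (add_le_add hSn norm_one_le)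
      _ ≤ 2 := by nlinarith
  set Tt : Matrix F I ℂ := P * T * S with hTt
  have hTtH : Ttᴴ = S * Tᴴ * P := by
    rw [hTt]; simp [hP, hS, Matrix.mul_assoc]
  have hTt1 : Ttᴴ * Tt = 1 := by
    rw [← hSKS, hTtH, hTt, hK]
    simp only [Matrix.mul_assoc]
    rw [← Matrix.mul_assoc P P, hPP]
  have hTt2 : Tt * Ttᴴ = P := by
    set D := P - Tt * Ttᴴ with hD
    have hDT : D * T = 0 := by
      have e : Tt * Ttᴴ * T = P * T * (S * S * K) := by
        rw [hTtH, hTt, hK]; simp only [Matrix.mul_assoc]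
      rw [hD, Matrix.sub_mul, e, hSSK, Matrix.mul_one, sub_self]
    have hDP : D * P = D := by
      rw [hD, Matrix.sub_mul, hPP, Matrix.mul_assoc, hTtH, Matrix.mul_assoc _ P P, hPP]
    have hDZ : D * Z = D := by
      rw [hZ, ← Matrix.mul_assoc, Matrix.mul_sub, ← Matrix.mul_assoc, hDT, Matrix.zero_mul,
        sub_zero, Matrix.mul_one, hDP]
    have hDn : ‖D‖ ≤ ‖D‖ * δ := by
      conv_lhs => rw [← hDZ]
      exact norm_mul_le_of_le le_rfl hZn
    have : D = 0 := by
      by_contra h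
      have h1 : 0 < ‖D‖ := norm_pos_iff.2 h
      have h2 : ‖D‖ * δ ≤ ‖D‖ * (1 / 250) := mul_le_mul_of_nonneg_left hδ1 h1.le
      linarith
    rw [hD, sub_eq_zero] at this
    exact this.symm
  have hTtn : ‖Tt‖ ≤ 1 := norm_le_one_of_conjTranspose_mul_self hTt1
  refine ⟨Tt, hTt1, hTt2, ?_, ?_⟩
  · have e : Tt - T = P * T * (S - 1) - X := by
      rw [hTt, hX, Matrix.mul_sub, Matrix.sub_mul, Matrix.mul_one, Matrix.one_mul]; abel
    rw [e]
    calc _ ≤ 1 * 1 * (2 * δ ^ 2) + δ := (norm_sub_le _ _).trans (add_le_add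
            (norm_mul_le_of_le (norm_mul_le_of_le hPn hTn) hSn) hXn)
      _ ≤ 25 * δ := by nlinarith
      _ = 100 * Λ / s := by rw [hδ]; ring
  set Y : Matrix I I ℂ := Tᴴ * (H₂ * G * H₂) * T with hY
  have hYn : ‖Y‖ ≤ Λ ^ 2 := by
    refine (norm_mul_le_of_le (norm_mul_le_of_le hTn' (norm_mul_le_of_le
      (norm_mul_le_of_le hn₂ hGn) hn₂)) hTn).trans_eq ?_
    ring
  set E : Matrix F I ℂ := G * Z * (H * P * T) + G * V * X with hE
  have hEn : ‖E‖ ≤ 16 * Λ ^ 2 := by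
    have h1 : ‖H * P * T‖ ≤ 1 * (2 * s * Λ * 1) := by
      rw [hHP, Matrix.mul_assoc, hHT]
      exact norm_mul_le_of_le hPn (norm_mul_le_of_le hVn hTn)
    refine ((norm_add_le _ _).trans (add_le_add
      (norm_mul_le_of_le (norm_mul_le_of_le hGn hZn) h1)
      (norm_mul_le_of_le (norm_mul_le_of_le hGn hVn) hXn))).trans_eq ?_
    rw [hδ]; field_simp; ring
  have hZT : ((s ^ 2 : ℝ) : ℂ) • (Z * T) = E - (s : ℂ) • (G * H₂ * T) := by
    have e1 : G * V * T = (s : ℂ) • (G * H₂ * T) := by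
      rw [hV, Matrix.mul_add, Matrix.add_mul, Matrix.mul_assoc G H₁, h₁T, ← Matrix.mul_assoc,
        hGT, Matrix.zero_mul, zero_add, Matrix.mul_smul, Matrix.smul_mul]
    have e2 : G * V * X = G * V * T - G * V * P * T := by
      rw [hX, Matrix.sub_mul, Matrix.mul_sub, Matrix.one_mul]; simp only [Matrix.mul_assoc]
    rw [← Matrix.smul_mul, hZeq, hE, e2, e1, Matrix.sub_mul]
    simp only [Matrix.mul_assoc]
    abel
  have hTV : Tᴴ * V * T = h₁ := by
    rw [hV, Matrix.mul_add, Matrix.add_mul, Matrix.mul_assoc Tᴴ H₁, h₁T, ← Matrix.mul_assoc,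
      hT, Matrix.one_mul, Matrix.mul_smul, Matrix.smul_mul, h₂T, smul_zero, add_zero]
  have hTH₁ : Tᴴ * H₁ = h₁ᴴ * Tᴴ := by
    have := congrArg conjTranspose h₁T
    rwa [conjTranspose_mul, conjTranspose_mul, hH₁] at this
  have hTZ : Tᴴ * Z = 0 := by
    rw [hZ, ← Matrix.mul_assoc, Matrix.mul_sub, ← Matrix.mul_assoc, hT]; simp
  have hTVZ : Tᴴ * V * Z = (s : ℂ) • (Tᴴ * H₂ * Z) := by
    rw [hV, Matrix.mul_add, Matrix.add_mul, hTH₁, Matrix.mul_assoc h₁ᴴ, hTZ, Matrix.mul_zero,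
      zero_add, Matrix.mul_smul, Matrix.smul_mul]
  have hTH : Tᴴ * H = Tᴴ * V := by
    have := congrArg conjTranspose hHT
    rwa [conjTranspose_mul, conjTranspose_mul, hHherm, hVherm] at this
  set e : Matrix I I ℂ := h₁ * (K - 1) + (s : ℂ)⁻¹ • (Tᴴ * H₂ * E) with he
  have hen : ‖e‖ ≤ 32 * Λ ^ 3 / s := by
    have h1 : ‖(s : ℂ)⁻¹ • (Tᴴ * H₂ * E)‖ ≤ s⁻¹ * (1 * Λ * (16 * Λ ^ 2)) := by
      rw [norm_smul, norm_inv, Complex.norm_real, Real.norm_eq_abs, abs_of_pos hs0]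
      have := norm_mul_le_of_le (norm_mul_le_of_le hTn' hn₂) hEn
      gcongr
    refine ((norm_add_le _ _).trans (add_le_add (norm_mul_le_of_le hn₁' hKn) h1)).trans ?_
    rw [hδ]
    have : Λ * (4 * Λ / s) ^ 2 ≤ 16 * Λ ^ 3 / s := by
      have : Λ * (4 * Λ / s) ^ 2 = 16 * Λ ^ 3 / s * (1 / s) := by field_simp; ring
      rw [this]
      refine mul_le_of_le_one_right (by positivity) ?_
      rw [div_le_one hs0]; linarith
    refine (add_le_add_left this _).trans_eq ?_
    field_simp; ring
  have heff : Tᴴ * H * P * T = h₁ - Y + e := by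
    have hsplit : P = T * Tᴴ * P + Z := by
      rw [hZ, Matrix.sub_mul, Matrix.one_mul]; abel
    have e1 : Tᴴ * V * P * T = h₁ * K + (s : ℂ) • (Tᴴ * H₂ * (Z * T)) := by
      conv_lhs => rw [hsplit]
      rw [Matrix.mul_add, Matrix.add_mul, hTVZ, Matrix.smul_mul, Matrix.mul_assoc _ Z T, hK]
      congr 1
      rw [← hTV]; simp only [Matrix.mul_assoc]
    have e2 : (s : ℂ) • (Z * T) = (s : ℂ)⁻¹ • E - G * H₂ * T := by
      have : (s : ℂ) • (Z * T) = (s : ℂ)⁻¹ • (((s ^ 2 : ℝ) : ℂ) • (Z * T)) := by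
        rw [smul_smul]; congr 1; push_cast; field_simp
      rw [this, hZT, smul_sub, smul_smul, inv_mul_cancel₀ hsC, one_smul]
    rw [hTH, e1, ← Matrix.mul_smul, e2, he, hY, Matrix.mul_sub, Matrix.mul_sub, Matrix.mul_smul,
      Matrix.mul_one]
    simp only [Matrix.mul_assoc]
    abel
  have hN : ‖h₁ - Y + e‖ ≤ 3 * Λ ^ 2 := by
    have h1 : 32 * Λ ^ 3 / s ≤ 1 * Λ ^ 2 := by
      rw [div_le_iff₀ hs0]
      nlinarith [sq_nonneg Λ]
    refine ((norm_add_le _ _).trans (add_le_add ((norm_sub_le _ _).trans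
      (add_le_add hn₁' hYn)) hen)).trans ?_
    nlinarith
  have hdiff : P * H * P - Tt * (h₁ - Y) * Ttᴴ =
      Tt * ((S - 1) * (h₁ - Y + e) * S + (h₁ - Y + e) * (S - 1) + e) * Ttᴴ := by
    have e1 : (S - 1) * (h₁ - Y + e) * S + (h₁ - Y + e) * (S - 1) + e =
        S * (h₁ - Y + e) * S - (h₁ - Y) := by
      generalize h₁ - Y = N
      noncomm_ring
    have e2 : S * (h₁ - Y + e) * S = Ttᴴ * H * Tt := by
      rw [← heff, hTtH, hTt]
      have : Tᴴ * H * P * T = Tᴴ * (P * (H * P)) * T := by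
        rw [hPHP]; simp only [Matrix.mul_assoc]
      rw [this]; simp only [Matrix.mul_assoc]
    rw [e1, e2, Matrix.mul_sub _ _ (h₁ - Y), Matrix.sub_mul _ _ Ttᴴ]
    congr 1
    rw [← hTt2]
    simp only [Matrix.mul_assoc]
  rw [hdiff]
  have hTtn' : ‖Ttᴴ‖ ≤ 1 := by rwa [l2_opNorm_conjTranspose]
  have hin := (norm_add_le ((S - 1) * (h₁ - Y + e) * S + (h₁ - Y + e) * (S - 1)) e).trans
    (add_le_add ((norm_add_le _ _).trans (add_le_add
      (norm_mul_le_of_le (norm_mul_le_of_le hSn hN) hSn2) (norm_mul_le_of_le hN hSn))) hen)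
  refine (norm_mul_le_of_le (norm_mul_le_of_le hTtn hin) hTtn').trans ?_
  have h4 : Λ ^ 4 / s ^ 2 ≤ Λ ^ 3 / s * (1 / 1000) := by
    have : Λ ^ 4 / s ^ 2 = Λ ^ 3 / s * (Λ / s) := by field_simp
    rw [this]
    refine mul_le_mul_of_nonneg_left ?_ (by positivity)
    rw [div_le_div_iff₀ hs0 (by norm_num)]; linarith
  have h5 : δ ^ 2 * Λ ^ 2 = 16 * (Λ ^ 4 / s ^ 2) := by rw [hδ]; field_simp; ring
  have h6 : 0 ≤ Λ ^ 3 / s := by positivity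
  have h7 : 1 * (2 * δ ^ 2 * (3 * Λ ^ 2) * 2 + 3 * Λ ^ 2 * (2 * δ ^ 2) + 32 * Λ ^ 3 / s) * 1 =
      18 * (δ ^ 2 * Λ ^ 2) + 32 * (Λ ^ 3 / s) := by ring
  rw [h7, h5, mul_div_assoc]
  linarith

theorem exists_isometry_specProjBelow {T : Matrix F I ℂ} {H₀ G H₁ H₂ : Matrix F F ℂ}
    {h₁ : Matrix I I ℂ} {Λ s : ℝ} (hT : Tᴴ * T = 1) (hH₀ : H₀.PosSemidef)
    (hGH : G * H₀ = 1 - T * Tᴴ) (hGn : ‖G‖ ≤ 1) (hGT : G * T = 0) (hH₀T : H₀ * T = 0)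
    (hH₁ : H₁ᴴ = H₁) (hH₂ : H₂ᴴ = H₂) (h₁T : H₁ * T = T * h₁) (h₂T : Tᴴ * H₂ * T = 0)
    (hn₁ : ‖H₁‖ ≤ Λ) (hn₁' : ‖h₁‖ ≤ Λ) (hn₂ : ‖H₂‖ ≤ Λ) (hΛ : 1 ≤ Λ) (hs : 1000 * Λ ≤ s)
    {H : Matrix F F ℂ} (hH : H = ((s ^ 2 : ℝ) : ℂ) • H₀ + H₁ + (s : ℂ) • H₂) :
    ∃ Tt : Matrix F I ℂ, Ttᴴ * Tt = 1 ∧ Tt * Ttᴴ = specProjBelow H (s ^ 2 / 2) ∧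
      ‖Tt - T‖ ≤ 100 * Λ / s ∧
      ‖specProjBelow H (s ^ 2 / 2) * H * specProjBelow H (s ^ 2 / 2) -
        Tt * (h₁ - Tᴴ * (H₂ * G * H₂) * T) * Ttᴴ‖ ≤ 100 * Λ ^ 3 / s := by
  have hs0 : 0 < s := by linarith
  set V : Matrix F F ℂ := H₁ + (s : ℂ) • H₂ with hV
  have hHV : H = ((s ^ 2 : ℝ) : ℂ) • H₀ + V := by rw [hH, hV, add_assoc]
  have hVherm : V.IsHermitian := by
    show Vᴴ = V
    rw [hV, conjTranspose_add, conjTranspose_smul, hH₁, hH₂]; simp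
  have hHherm : H.IsHermitian := by
    show Hᴴ = H
    rw [hHV, conjTranspose_add, conjTranspose_smul, hH₀.1, hVherm]; simp
  have hVn : ‖V‖ ≤ s ^ 2 / 2 := by
    have : ‖(s : ℂ) • H₂‖ ≤ s * Λ := by
      rw [norm_smul, Complex.norm_real, Real.norm_eq_abs, abs_of_pos hs0]
      gcongr
    calc ‖V‖ ≤ Λ + s * Λ := (norm_add_le _ _).trans (add_le_add hn₁ this)
      _ ≤ _ := by nlinarith
  have hlow : (H + ((s ^ 2 / 2 : ℝ) : ℂ) • 1).PosSemidef := by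
    have e : H + ((s ^ 2 / 2 : ℝ) : ℂ) • 1 = ((s ^ 2 : ℝ) : ℂ) • H₀ + (V + (‖V‖ : ℂ) • 1) +
        ((s ^ 2 / 2 - ‖V‖ : ℝ) : ℂ) • 1 := by
      rw [hHV]; push_cast; module
    rw [e]
    refine ((hH₀.smul ?_).add (posSemidef_add_norm hVherm)).add (PosSemidef.one.smul ?_)
    · exact Complex.zero_le_real.2 (by positivity)
    · exact Complex.zero_le_real.2 (by linarith)
  obtain ⟨hP, hPP, hHP, hHPn, R, hR, hRn⟩ := specProjBelow_spec hHherm (by positivity) hlow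
  exact exists_isometry_of_reducing hT hH₀.1 hGH hGn hGT hH₀T hH₁ hH₂ h₁T h₂T hn₁ hn₁' hn₂ hΛ hs
    hH hP hPP hHP hHPn hR hRn

end Perturbation

end QSim

namespace QSim

open scoped Matrix.Norms.L2Operator

section Qubits

variable {n : ℕ}

lemma oneQubitOp_mulVec (i : Fin n) (E : Matrix (Fin 2) (Fin 2) ℂ) (v : QIdx n → ℂ)
    (x : QIdx n) :
    (oneQubitOp n i E *ᵥ v) x = ∑ b, E (x i) b * v (Function.update x i b) := by
  symm
  refine Fintype.sum_of_injective (fun b => Function.update x i b)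
    (Function.update_injective x i) _ _ ?_ ?_
  · intro y hy
    simp only [oneQubitOp]
    rw [if_neg, mul_zero, zero_mul]
    intro h
    refine hy ⟨y i, ?_⟩
    ext k : 1
    by_cases hk : k = i
    · subst hk; simp
    · simp [hk, h k hk]
  · intro b
    simp only [oneQubitOp, Function.update_self]
    rw [if_pos, mul_one]
    intro k hk
    simp [hk]

lemma twoQubitOp_mulVec {i j : Fin n} (hij : i ≠ j) (E : Fin 2 → Fin 2 → Fin 2 → Fin 2 → ℂ)
    (v : QIdx n → ℂ) (x : QIdx n) :
    (twoQubitOp n i j E *ᵥ v) x =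
      ∑ b : Fin 2 × Fin 2, E (x i) (x j) b.1 b.2 *
        v (Function.update (Function.update x i b.1) j b.2) := by
  symm
  refine Fintype.sum_of_injective
    (fun b : Fin 2 × Fin 2 => Function.update (Function.update x i b.1) j b.2) ?_ _ _ ?_ ?_
  · intro b c h
    have h1 := congrFun h i
    have h2 := congrFun h j
    simp only [Function.update_self, Function.update_of_ne hij] at h1 h2
    exact Prod.ext h1 h2
  · intro y hy
    simp only [twoQubitOp]
    rw [if_neg, mul_zero, zero_mul]
    intro h
    refine hy ⟨(y i, y j), ?_⟩
    ext k : 1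
    by_cases hk : k = j
    · subst hk; simp
    · by_cases hk' : k = i
      · subst hk'; simp [hk]
      · simp [hk, hk', h k hk' hk]
  · intro b
    simp only [twoQubitOp, Function.update_self, Function.update_of_ne hij]
    rw [if_pos, mul_one]
    intro k hk hk'
    simp [hk, hk']

lemma oneQubitOp_mul (i : Fin n) (E F : Matrix (Fin 2) (Fin 2) ℂ) :
    oneQubitOp n i E * oneQubitOp n i F = oneQubitOp n i (E * F) := by
  refine Matrix.mulVec_injective (funext fun v => funext fun x => ?_)
  rw [← mulVec_mulVec]
  simp only [oneQubitOp_mulVec, Function.update_self, Function.update_idem, Matrix.mul_apply,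
    Finset.mul_sum, Finset.sum_mul]
  rw [Finset.sum_comm]
  simp only [mul_assoc]

lemma oneQubitOp_one (i : Fin n) : oneQubitOp n i 1 = 1 := by
  refine Matrix.mulVec_injective (funext fun v => funext fun x => ?_)
  simp [oneQubitOp_mulVec, Matrix.one_apply]

lemma oneQubitOp_conjTranspose (i : Fin n) (E : Matrix (Fin 2) (Fin 2) ℂ) :
    (oneQubitOp n i E)ᴴ = oneQubitOp n i Eᴴ := by
  ext x y
  have : (∀ k, k ≠ i → y k = x k) ↔ (∀ k, k ≠ i → x k = y k) :=
    forall₂_congr fun _ _ => eq_comm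
  simp only [oneQubitOp, conjTranspose_apply, this]
  split_ifs <;> simp

lemma oneQubitOp_comm {i j : Fin n} (hij : i ≠ j) (E F : Matrix (Fin 2) (Fin 2) ℂ) :
    oneQubitOp n i E * oneQubitOp n j F = oneQubitOp n j F * oneQubitOp n i E := by
  refine Matrix.mulVec_injective (funext fun v => funext fun x => ?_)
  rw [← mulVec_mulVec, ← mulVec_mulVec]
  simp only [oneQubitOp_mulVec, Function.update_of_ne hij, Function.update_of_ne hij.symm,
    Finset.mul_sum]
  rw [Finset.sum_comm]
  refine Finset.sum_congr rfl fun b _ => Finset.sum_congr rfl fun c _ => ?_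
  rw [Function.update_comm hij]
  ring

lemma Xmat_mul_self : Xmat * Xmat = 1 := by
  ext a b; fin_cases a <;> fin_cases b <;> simp [Xmat]

lemma Xmat_conjTranspose : Xmatᴴ = Xmat := by
  ext a b; fin_cases a <;> fin_cases b <;> simp [Xmat]

lemma Xop_mul_self (i : Fin n) : Xop n i * Xop n i = 1 := by
  rw [Xop, oneQubitOp_mul, Xmat_mul_self, oneQubitOp_one]

lemma Xop_conjTranspose (i : Fin n) : (Xop n i)ᴴ = Xop n i := by
  rw [Xop, oneQubitOp_conjTranspose, Xmat_conjTranspose]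

lemma one_sub_Zmat_div_two : (1 - Zmat) / 2 = !![0, 0; 0, 1] := by
  have h2 : (2 : Matrix (Fin 2) (Fin 2) ℂ) = (2 : ℂ) • 1 := by
    rw [← Algebra.algebraMap_eq_smul_one]; exact (map_ofNat (algebraMap ℂ (Matrix (Fin 2) (Fin 2) ℂ)) 2).symm
  have hinv : (2 : Matrix (Fin 2) (Fin 2) ℂ)⁻¹ = (1 / 2 : ℂ) • 1 := by
    refine Matrix.inv_eq_right_inv ?_
    rw [h2, smul_mul_smul_comm, Matrix.one_mul]; norm_num
  rw [div_eq_mul_inv, hinv]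
  ext a b; fin_cases a <;> fin_cases b <;> simp [Zmat] ; norm_num

/-- The basis label with a single `1` at position `k`. -/
def singleIdx (k : Fin n) : QIdx n := Pi.single k 1

/-- The number operator `∑ᵢ (1 - Zᵢ)/2`. -/
noncomputable def numOp (n : ℕ) : QOp n := ∑ i : Fin n, oneQubitOp n i ((1 - Zmat) / 2)

lemma numOp_eq_diagonal : numOp n = diagonal fun x => ((∑ i, (x i : ℕ) : ℕ) : ℂ) := by
  refine Matrix.mulVec_injective (funext fun v => funext fun x => ?_)
  simp only [numOp, sum_mulVec, Finset.sum_apply, mulVec_diagonal, oneQubitOp_mulVec,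
    one_sub_Zmat_div_two, Nat.cast_sum, Finset.sum_mul]
  refine Finset.sum_congr rfl fun i _ => ?_
  have hx : Function.update x i (x i) = x := Function.update_eq_self i x
  have h : ∀ a : Fin 2, x i = a → 
      ∑ b, !![(0:ℂ), 0; 0, 1] (x i) b * v (Function.update x i b) = ((x i : ℕ) : ℂ) * v x := by
    intro a ha
    rw [ha] at hx ⊢
    fin_cases a
    · simp
    · simpa using congrArg v hx
  exact h _ rfl

lemma sum_eq_card_filter (x : QIdx n) :
    ∑ i, (x i : ℕ) = (Finset.univ.filter fun k => x k = 1).card := by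
  rw [Finset.card_filter]
  refine Finset.sum_congr rfl fun i _ => ?_
  generalize x i = a
  fin_cases a <;> simp

lemma card_filter_eq_one_iff (x : QIdx n) :
    (Finset.univ.filter fun k => x k = 1).card = 1 ↔ ∃ k, x = singleIdx k := by
  rw [Finset.card_eq_one]
  refine exists_congr fun k => ?_
  rw [Finset.ext_iff, funext_iff]
  refine forall_congr' fun l => ?_
  simp only [Finset.mem_filter, Finset.mem_univ, true_and, Finset.mem_singleton, singleIdx,
    Pi.single_apply]
  by_cases h : l = k
  · simp [h]
  · simp only [h, iff_false, if_false]
    generalize x l = a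
    fin_cases a <;> simp

lemma singleIdx_injective : Function.Injective (singleIdx (n := n)) := fun a b h => by
  by_contra hab
  have := congrFun h a
  simp [singleIdx, hab] at this

lemma Wstate_singleIdx (k : Fin n) : Wstate n (singleIdx k) = (((√n)⁻¹ : ℝ) : ℂ) := by
  rw [Wstate, if_pos ((card_filter_eq_one_iff _).2 ⟨k, rfl⟩)]

lemma Wstate_of_ne {x : QIdx n} (h : ∀ k, x ≠ singleIdx k) : Wstate n x = 0 := by
  rw [Wstate, if_neg]
  rw [card_filter_eq_one_iff]
  rintro ⟨k, hk⟩
  exact h k hk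

lemma star_Wstate : star (Wstate n) = Wstate n := by
  ext x
  simp only [Pi.star_apply, Wstate]
  split_ifs <;> simp

lemma Wstate_dotProduct (v : QIdx n → ℂ) :
    Wstate n ⬝ᵥ v = (((√n)⁻¹ : ℝ) : ℂ) * ∑ k, v (singleIdx k) := by
  rw [Finset.mul_sum]
  symm
  refine Fintype.sum_of_injective singleIdx singleIdx_injective _ _ ?_ ?_
  · intro x hx
    rw [Wstate_of_ne fun k hk => hx ⟨k, hk.symm⟩, zero_mul]
  · intro k
    rw [Wstate_singleIdx]

lemma inv_sqrt_mul_inv_sqrt (n : ℕ) : (((√n)⁻¹ : ℝ) : ℂ) * (((√n)⁻¹ : ℝ) : ℂ) = (n : ℂ)⁻¹ := by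
  rw [← Complex.ofReal_mul, ← mul_inv, Real.mul_self_sqrt (Nat.cast_nonneg n)]
  simp

lemma Wstate_dotProduct_self (hn : n ≠ 0) : Wstate n ⬝ᵥ Wstate n = 1 := by
  rw [Wstate_dotProduct]
  simp only [Wstate_singleIdx, Finset.sum_const, Finset.card_univ, Fintype.card_fin, nsmul_eq_mul]
  rw [mul_left_comm, inv_sqrt_mul_inv_sqrt, mul_inv_cancel₀ (Nat.cast_ne_zero.2 hn)]

lemma ket0_eq (n : ℕ) : ket0 n = Pi.single 0 1 := by
  ext x
  simp [ket0, Pi.single_apply, funext_iff]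

lemma singleIdx_ne_zero (k : Fin n) : singleIdx k ≠ 0 := fun h => by
  simpa [singleIdx] using congrFun h k

lemma Wstate_zero : Wstate n 0 = 0 := Wstate_of_ne fun k => (singleIdx_ne_zero k).symm

lemma numOp_mulVec_Wstate : numOp n *ᵥ Wstate n = Wstate n := by
  ext x
  rw [numOp_eq_diagonal, mulVec_diagonal, sum_eq_card_filter, Wstate]
  split_ifs with h
  · simp [h]
  · simp

lemma numOp_mulVec_ket0 : numOp n *ᵥ ket0 n = 0 := by
  ext x
  rw [numOp_eq_diagonal, mulVec_diagonal, ket0_eq, Pi.single_apply]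
  split_ifs with h
  · simp [h]
  · simp

end Qubits

end QSim

namespace QSim

open scoped Matrix.Norms.L2Operator

section ParentHamiltonian

variable {n : ℕ}

lemma Pentry_mul (a b e f : Fin 2) :
    ∑ c : Fin 2 × Fin 2, Pentry a b c.1 c.2 * Pentry c.1 c.2 e f = Pentry a b e f := by
  rw [Fintype.sum_prod_type]
  simp only [Fin.sum_univ_two]
  fin_cases a <;> fin_cases b <;> fin_cases e <;> fin_cases f <;>
    norm_num [Pentry, sgnE]

lemma Pentry_star (a b c d : Fin 2) : star (Pentry a b c d) = Pentry c d a b := by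
  fin_cases a <;> fin_cases b <;> fin_cases c <;> fin_cases d <;>
    norm_num [Pentry, sgnE]

lemma twoQubitOp_Pentry_mul_self {i j : Fin n} (hij : i ≠ j) :
    twoQubitOp n i j Pentry * twoQubitOp n i j Pentry = twoQubitOp n i j Pentry := by
  refine Matrix.mulVec_injective (funext fun v => funext fun x => ?_)
  rw [← mulVec_mulVec, twoQubitOp_mulVec hij, twoQubitOp_mulVec hij]
  simp only [twoQubitOp_mulVec hij, Finset.mul_sum, Function.update_self,
    Function.update_of_ne hij]
  rw [Finset.sum_comm]
  refine Finset.sum_congr rfl fun c _ => ?_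
  rw [← Pentry_mul (x i) (x j) c.1 c.2, Finset.sum_mul]
  refine Finset.sum_congr rfl fun b _ => ?_
  rw [Function.update_comm hij.symm, Function.update_idem, Function.update_idem, mul_assoc]

lemma twoQubitOp_Pentry_conjTranspose (i j : Fin n) :
    (twoQubitOp n i j Pentry)ᴴ = twoQubitOp n i j Pentry := by
  ext x y
  have : (∀ k, k ≠ i → k ≠ j → y k = x k) ↔ (∀ k, k ≠ i → k ≠ j → x k = y k) :=
    forall₃_congr fun _ _ _ => eq_comm
  simp only [twoQubitOp, conjTranspose_apply, this, star_mul', Pentry_star]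
  split_ifs <;> simp

lemma twoQubitOp_Pentry_posSemidef {i j : Fin n} (hij : i ≠ j) :
    (twoQubitOp n i j Pentry).PosSemidef := by
  have := posSemidef_conjTranspose_mul_self (twoQubitOp n i j Pentry)
  rwa [twoQubitOp_Pentry_conjTranspose, twoQubitOp_Pentry_mul_self hij] at this

/-- The kernel of the local term consists of the vectors that vanish on labels with `11` and are
invariant under exchanging `01` with `10`. -/
lemma twoQubitOp_Pentry_mulVec_eq_zero {i j : Fin n} (hij : i ≠ j) {v : QIdx n → ℂ} :
    twoQubitOp n i j Pentry *ᵥ v = 0 ↔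
      (∀ x : QIdx n, x i = 1 → x j = 1 → v x = 0) ∧
      (∀ x : QIdx n, x i = 1 → x j = 0 →
        v x = v (Function.update (Function.update x i 0) j 1)) := by
  have hself : ∀ (x : QIdx n) (a b : Fin 2), x i = a → x j = b →
      Function.update (Function.update x i a) j b = x := by
    rintro x a b rfl rfl
    simp
  constructor
  · intro h
    constructor
    · intro x hi hj
      have := congrFun h x
      rw [twoQubitOp_mulVec hij, Fintype.sum_prod_type] at this
      simpa [Fin.sum_univ_two, hi, hj, Pentry, sgnE, hself x 1 1 hi hj] using this
    · intro x hi hj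
      have := congrFun h x
      rw [twoQubitOp_mulVec hij, Fintype.sum_prod_type] at this
      simp [Fin.sum_univ_two, hi, hj, Pentry, sgnE, hself x 1 0 hi hj] at this
      linear_combination 2 * this
  · rintro ⟨h1, h2⟩
    ext x
    rw [twoQubitOp_mulVec hij, Fintype.sum_prod_type]
    have h10 : v (Function.update (Function.update x i 1) j 0) =
        v (Function.update (Function.update x i 0) j 1) := by
      rw [h2 _ (by simp [hij]) (by simp)]
      congr 1
      rw [Function.update_comm hij.symm, Function.update_idem, Function.update_idem]
    have h11 : v (Function.update (Function.update x i 1) j 1) = 0 :=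
      h1 _ (by simp [hij]) (by simp)
    simp only [Fin.sum_univ_two, h10, h11, Pi.zero_apply]
    generalize x i = a
    generalize x j = b
    fin_cases a <;> fin_cases b <;> simp [Pentry, sgnE]

lemma HW0_posSemidef (n : ℕ) : (HW0 n).PosSemidef :=
  posSemidef_sum _ fun i _ => twoQubitOp_Pentry_posSemidef (by simp [Fin.ext_iff])

lemma HW0_mulVec_eq_zero {v : QIdx n → ℂ} : HW0 n *ᵥ v = 0 ↔
    ∀ (k : ℕ) (hk : k + 1 < n),
      (∀ x : QIdx n, x ⟨k, by omega⟩ = 1 → x ⟨k + 1, hk⟩ = 1 → v x = 0) ∧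
      (∀ x : QIdx n, x ⟨k, by omega⟩ = 1 → x ⟨k + 1, hk⟩ = 0 →
        v x = v (Function.update (Function.update x ⟨k, by omega⟩ 0) ⟨k + 1, hk⟩ 1)) := by
  have key : HW0 n *ᵥ v = 0 ↔ ∀ i : Fin (n - 1),
      twoQubitOp n ⟨i.1, by have := i.2; omega⟩ ⟨i.1 + 1, by have := i.2; omega⟩ Pentry *ᵥ v
        = 0 := by
    have hP : ∀ i : Fin (n - 1),
      (twoQubitOp n ⟨i.1, by have := i.2; omega⟩ ⟨i.1 + 1, by have := i.2; omega⟩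
        Pentry).PosSemidef := fun i => twoQubitOp_Pentry_posSemidef (by simp [Fin.ext_iff])
    constructor
    · intro h i
      rw [← (hP i).dotProduct_mulVec_zero_iff]
      have h1 := ((HW0_posSemidef n).dotProduct_mulVec_zero_iff v).2 h
      rw [HW0, sum_mulVec, dotProduct_sum,
        Finset.sum_eq_zero_iff_of_nonneg fun i _ => (hP i).dotProduct_mulVec_nonneg v] at h1
      exact h1 i (Finset.mem_univ i)
    · intro h
      rw [HW0, sum_mulVec]
      exact Finset.sum_eq_zero fun i _ => h i
  rw [key]
  constructor
  · intro h k hk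
    exact (twoQubitOp_Pentry_mulVec_eq_zero (by simp [Fin.ext_iff])).1 (h ⟨k, by omega⟩)
  · intro h i
    exact (twoQubitOp_Pentry_mulVec_eq_zero (by simp [Fin.ext_iff])).2 (h i.1 (by omega))

lemma HW0_mulVec_ket0 (n : ℕ) : HW0 n *ᵥ ket0 n = 0 := by
  rw [HW0_mulVec_eq_zero, ket0_eq]
  intro k hk
  have h0 : ∀ (x : QIdx n) (l : Fin n), x l = 1 → (Pi.single 0 1 : QIdx n → ℂ) x = 0 := by
    intro x l hl
    rw [Pi.single_apply, if_neg]
    rintro rfl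
    simp at hl
  refine ⟨fun x hx _ => h0 x _ hx, fun x hx hx' => ?_⟩
  rw [h0 x _ hx, h0 _ ⟨k + 1, hk⟩ (by simp)]

lemma HW0_mulVec_Wstate (n : ℕ) : HW0 n *ᵥ Wstate n = 0 := by
  rw [HW0_mulVec_eq_zero]
  intro k hk
  constructor
  · intro x hx hx'
    refine Wstate_of_ne ?_
    rintro l rfl
    simp only [singleIdx, Pi.single_apply] at hx hx'
    split_ifs at hx hx' with h1 h2
    · simp [← h1] at h2
    all_goals simp at hx hx'
  · intro x hx hx'
    have hcard : (Finset.univ.filter fun l => x l = 1).card =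
      (Finset.univ.filter fun l =>
        Function.update (Function.update x ⟨k, by omega⟩ 0) ⟨k + 1, hk⟩ 1 l = 1).card := by
      refine Finset.card_equiv (Equiv.swap ⟨k, by omega⟩ ⟨k + 1, hk⟩) fun l => ?_
      simp only [Finset.mem_filter, Finset.mem_univ, true_and]
      by_cases h1 : l = ⟨k, by omega⟩
      · subst h1; simp [hx]
      by_cases h2 : l = ⟨k + 1, hk⟩
      · subst h2
        rw [Equiv.swap_apply_right, Function.update_of_ne (by simp [Fin.ext_iff])]
        simp [hx']
      · rw [Equiv.swap_apply_of_ne_of_ne h1 h2, Function.update_of_ne h2,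
          Function.update_of_ne h1]
    simp only [Wstate, hcard]

/-- The kernel of `HW0` is spanned by the all-zeros state and the W state. -/
lemma eq_of_HW0_mulVec_eq_zero (hn : n ≠ 0) {v : QIdx n → ℂ} (h : HW0 n *ᵥ v = 0) :
    ∃ a b : ℂ, v = a • ket0 n + b • Wstate n := by
  rw [HW0_mulVec_eq_zero] at h
  have two : ∀ (d p : ℕ) (hd : p + d + 1 < n) (x : QIdx n), x ⟨p, by omega⟩ = 1 →
      x ⟨p + d + 1, hd⟩ = 1 → v x = 0 := by
    intro d
    induction d with
    | zero => exact fun p hd x hx hx' => (h p hd).1 x hx hx'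
    | succ d ih =>
      intro p hd x hx hx'
      have e : (⟨p + (d + 1) + 1, hd⟩ : Fin n) = ⟨p + 1 + d + 1, by omega⟩ := by
        rw [Fin.ext_iff]; simp only; omega
      rw [e] at hx'
      obtain h0 | h1 : x ⟨p + 1, by omega⟩ = 0 ∨ x ⟨p + 1, by omega⟩ = 1 := by
        generalize x ⟨p + 1, by omega⟩ = a
        fin_cases a <;> simp
      · rw [(h p (by omega)).2 x hx h0]
        refine ih (p + 1) (by omega) _ (by simp) ?_
        rw [Function.update_of_ne (by simp [Fin.ext_iff]; omega),
          Function.update_of_ne (by simp [Fin.ext_iff]; omega), hx']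
      · exact ih (p + 1) (by omega) x h1 hx'
  have one : ∀ (k : ℕ) (hk : k < n), v (singleIdx ⟨k, hk⟩) = v (singleIdx ⟨0, by omega⟩) := by
    intro k
    induction k with
    | zero => exact fun _ => rfl
    | succ k ih =>
      intro hk
      rw [← ih (by omega), (h k hk).2 (singleIdx ⟨k, by omega⟩) (by simp [singleIdx])
        (by simp [singleIdx])]
      congr 1
      ext l : 1
      by_cases h2 : l = ⟨k + 1, hk⟩
      · subst h2; simp [singleIdx]
      by_cases h1 : l = ⟨k, by omega⟩
      · subst h1; simp [singleIdx]
      · simp [singleIdx, h1, h2]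
  refine ⟨v 0, √n * v (singleIdx ⟨0, by omega⟩), ?_⟩
  ext x
  simp only [Pi.add_apply, Pi.smul_apply, smul_eq_mul, ket0_eq]
  by_cases hx0 : x = 0
  · subst hx0; simp [Wstate_zero]
  rw [Pi.single_eq_of_ne hx0, mul_zero, zero_add]
  by_cases hx1 : ∃ k, x = singleIdx k
  · obtain ⟨k, rfl⟩ := hx1
    have hs : ((√n : ℝ) : ℂ) ≠ 0 := by
      rw [Complex.ofReal_ne_zero]; positivity
    rw [Wstate_singleIdx, Complex.ofReal_inv, one k.1 k.2]
    field_simp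
  · push Not at hx1
    rw [Wstate_of_ne hx1, mul_zero]
    obtain ⟨p, hp⟩ : ∃ p, x p ≠ 0 := by
      by_contra! hc
      exact hx0 (funext hc)
    have hp1 : x p = 1 := by
      generalize x p = a at *
      fin_cases a <;> simp at *
    obtain ⟨q, hqp, hq⟩ : ∃ q, q ≠ p ∧ x q ≠ 0 := by
      by_contra! hc
      refine hx1 p (funext fun l => ?_)
      by_cases hl : l = p
      · subst hl; simp [singleIdx, hp1]
      · simp [singleIdx, hl, hc l hl]
    have hq1 : x q = 1 := by
      generalize x q = a at *
      fin_cases a <;> simp at *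
    rcases lt_or_gt_of_ne hqp with hlt | hlt
    · obtain ⟨d, hd⟩ : ∃ d, p.1 = q.1 + d + 1 := ⟨p.1 - q.1 - 1, by
        have := Fin.lt_def.1 hlt; omega⟩
      refine two d q.1 (by omega) x hq1 ?_
      convert hp1 using 2
      exact Fin.ext hd.symm
    · obtain ⟨d, hd⟩ : ∃ d, q.1 = p.1 + d + 1 := ⟨q.1 - p.1 - 1, by
        have := Fin.lt_def.1 hlt; omega⟩
      refine two d p.1 (by omega) x hp1 ?_
      convert hq1 using 2
      exact Fin.ext hd.symm

end ParentHamiltonian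

end QSim

namespace QSim

open scoped Matrix.Norms.L2Operator

section SpectralGap

variable {I : Type*} [Fintype I] [DecidableEq I]

lemma posSemidef_sub_of_spectrum {M E : Matrix I I ℂ} (hM : M.PosSemidef) (hE : Eᴴ = E)
    (hME : M * E = M) (hker : ∀ v, M *ᵥ v = 0 → E *ᵥ v = 0) {lam : ℝ}
    (hlam : ∀ μ : ℝ, (μ : ℂ) ∈ spectrum ℂ M → μ ≠ 0 → lam ≤ μ) :
    (M - (lam : ℂ) • E).PosSemidef := by
  have hH := hM.isHermitian
  set e := hH.eigenvalues with he
  set r : I → ℂ := fun k => if e k = 0 then 0 else 1 with hr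
  have hqM : M * (1 - specFn hH r) = 0 := by
    have h1 : (1 - specFn hH r) = specFn hH (fun k => 1 - r k) := by
      rw [specFn_sub, specFn_one]
    have h2 : M * specFn hH (fun k => 1 - r k) =
        specFn hH (fun k => (e k : ℂ) * (1 - r k)) := by
      rw [← specFn_mul, specFn_eigenvalues]
    have h3 : (fun k => (e k : ℂ) * (1 - r k)) = fun _ => 0 * 1 := by
      ext k
      simp only [hr]
      split_ifs with h <;> simp [h]
    rw [h1, h2, h3, specFn_const_mul, zero_smul]
  have hEq : E * (1 - specFn hH r) = 0 := by
    refine Matrix.mulVec_injective (funext fun v => ?_)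
    rw [← mulVec_mulVec, zero_mulVec]
    refine hker _ ?_
    rw [mulVec_mulVec, hqM, zero_mulVec]
  have hq : specFn hH r * E = specFn hH r := by
    have h1 : specFn hH r = specFn hH (fun k => (e k : ℂ)⁻¹) * M := by
      rw [specFn_mul_right]
      congr 1
      ext k
      simp only [hr]
      split_ifs with h
      · simp [← he, h]
      · rw [← he, inv_mul_cancel₀ (Complex.ofReal_ne_zero.2 h)]
    rw [h1, Matrix.mul_assoc, hME]
  have hq' : E * specFn hH r = specFn hH r := by
    have h1 : (specFn hH r)ᴴ = specFn hH r := by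
      rw [specFn_conjTranspose]
      congr 1
      ext k
      simp only [hr, Pi.star_apply]
      split_ifs <;> simp
    have := congrArg conjTranspose hq
    rwa [conjTranspose_mul, hE, h1] at this
  have hEe : E = specFn hH r := by
    rw [Matrix.mul_sub, Matrix.mul_one, sub_eq_zero, hq'] at hEq
    exact hEq
  have e1 : M - (lam : ℂ) • E = specFn hH (fun k => (e k : ℂ) - lam * r k) := by
    rw [specFn_sub, specFn_const_mul, specFn_eigenvalues, hEe]
  rw [e1, posSemidef_specFn_iff]
  intro k
  simp only [hr]
  split_ifs with h
  · simp [h]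
  · have h1 : lam ≤ e k := hlam _ (by
      have h2 := hH.spectrum_eq_image_range (𝕜 := ℂ)
      rw [h2]
      exact ⟨e k, ⟨k, rfl⟩, rfl⟩) h
    rw [mul_one, ← Complex.ofReal_sub, Complex.zero_le_real]
    linarith

end SpectralGap

section Green

variable {n : ℕ}

/-- The projector onto the all-zeros state. -/
def projZero (n : ℕ) : QOp n := vecMulVec (ket0 n) (ket0 n)

lemma star_ket0 : star (ket0 n) = ket0 n := by
  rw [ket0_eq]; simp

lemma projW_eq (n : ℕ) : projW n = vecMulVec (Wstate n) (Wstate n) := rfl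

lemma projW_conjTranspose : (projW n)ᴴ = projW n := by
  rw [projW_eq, conjTranspose_vecMulVec, star_Wstate]

lemma projZero_conjTranspose : (projZero n)ᴴ = projZero n := by
  rw [projZero, conjTranspose_vecMulVec, star_ket0]

lemma ket0_dotProduct (v : QIdx n → ℂ) : ket0 n ⬝ᵥ v = v 0 := by
  rw [ket0_eq, single_dotProduct, one_mul]

lemma projW_mul_self (hn : n ≠ 0) : projW n * projW n = projW n := by
  rw [projW_eq, vecMulVec_mul_vecMulVec, Wstate_dotProduct_self hn, one_smul]

lemma projZero_mul_self : projZero n * projZero n = projZero n := by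
  rw [projZero, vecMulVec_mul_vecMulVec, ket0_dotProduct, ket0_eq]; simp

lemma projZero_mul_projW : projZero n * projW n = 0 := by
  rw [projZero, projW_eq, vecMulVec_mul_vecMulVec, ket0_dotProduct, Wstate_zero]; simp

lemma projW_mul_projZero : projW n * projZero n = 0 := by
  have := congrArg conjTranspose (projZero_mul_projW (n := n))
  rwa [conjTranspose_mul, projZero_conjTranspose, projW_conjTranspose, conjTranspose_zero] at this

lemma numOp_mul_projW : numOp n * projW n = projW n := by
  rw [projW_eq, mul_vecMulVec, numOp_mulVec_Wstate]

lemma numOp_mul_projZero : numOp n * projZero n = 0 := by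
  rw [projZero, mul_vecMulVec, numOp_mulVec_ket0, zero_vecMulVec]

lemma numOp_conjTranspose : (numOp n)ᴴ = numOp n := by
  rw [numOp_eq_diagonal, diagonal_conjTranspose]
  congr 1
  ext x
  simp

lemma projW_mul_numOp : projW n * numOp n = projW n := by
  have := congrArg conjTranspose (numOp_mul_projW (n := n))
  rwa [conjTranspose_mul, numOp_conjTranspose, projW_conjTranspose] at this

lemma projZero_mul_numOp : projZero n * numOp n = 0 := by
  have := congrArg conjTranspose (numOp_mul_projZero (n := n))
  rwa [conjTranspose_mul, numOp_conjTranspose, projZero_conjTranspose, conjTranspose_zero] at this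

/-- The projector onto the complement of the all-zeros state and the W state. -/
noncomputable def projRest (n : ℕ) : QOp n := 1 - projW n - projZero n

lemma projRest_conjTranspose : (projRest n)ᴴ = projRest n := by
  simp [projRest, projW_conjTranspose, projZero_conjTranspose]

lemma projRest_mul_self (hn : n ≠ 0) : projRest n * projRest n = projRest n := by
  simp only [projRest, Matrix.mul_sub, Matrix.sub_mul, Matrix.mul_one, Matrix.one_mul,
    projW_mul_self hn, projZero_mul_self, projZero_mul_projW, projW_mul_projZero]
  abel

lemma posSemidef_of_isIdempotent {I : Type*} [Fintype I] {P : Matrix I I ℂ} (h : Pᴴ = P)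
    (h2 : P * P = P) : P.PosSemidef := by
  have := posSemidef_conjTranspose_mul_self P
  rwa [h, h2] at this

lemma HW0_sub_posSemidef (hn : n ≠ 0) {lam : ℝ}
    (hlam : ∀ μ : ℝ, (μ : ℂ) ∈ spectrum ℂ (HW0 n) → μ ≠ 0 → lam ≤ μ) :
    (HW0 n - (lam : ℂ) • projRest n).PosSemidef := by
  refine posSemidef_sub_of_spectrum (HW0_posSemidef n) projRest_conjTranspose ?_ ?_ hlam
  · rw [projRest, Matrix.mul_sub, Matrix.mul_sub, projW_eq, projZero, mul_vecMulVec,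
      mul_vecMulVec, HW0_mulVec_Wstate, HW0_mulVec_ket0]
    simp
  · intro v hv
    obtain ⟨a, b, rfl⟩ := eq_of_HW0_mulVec_eq_zero hn hv
    simp only [projRest, sub_mulVec, one_mulVec, projW_eq, projZero, vecMulVec_mulVec,
      dotProduct_add, dotProduct_smul, ket0_dotProduct, Wstate_dotProduct_self hn, Wstate_zero]
    rw [dotProduct_comm, ket0_dotProduct, Wstate_zero, ket0_eq]
    simp

lemma HWham_eq (Γ : ℝ) : HWham n Γ = (Γ : ℂ) • HW0 n + 1 - numOp n := rfl

/-- The W-state Hamiltonian dominates the all-zeros projector plus `4n` times the projector onto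
the remaining excited space. -/
lemma HWham_sub_posSemidef (hn : n ≠ 0) {lam Γ : ℝ} (hl : 0 < lam)
    (hlam : ∀ μ : ℝ, (μ : ℂ) ∈ spectrum ℂ (HW0 n) → μ ≠ 0 → lam ≤ μ)
    (hΓ : 5 * (n : ℝ) < Γ * lam + 1) :
    (HWham n Γ - ((4 * n : ℝ) : ℂ) • projRest n - projZero n).PosSemidef := by
  have hn1 : (1 : ℝ) ≤ n := by exact_mod_cast Nat.one_le_iff_ne_zero.2 hn
  have hΓ0 : 0 ≤ Γ := by
    by_contra hc
    nlinarith
  have hE := projRest_conjTranspose (n := n)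
  have hEE := projRest_mul_self hn
  have key : HWham n Γ - ((4 * n : ℝ) : ℂ) • projRest n - projZero n =
      (Γ : ℂ) • (HW0 n - (lam : ℂ) • projRest n) +
      (projRest n)ᴴ * ((n : ℂ) • 1 - numOp n) * projRest n +
      ((Γ * lam + 1 - 5 * n : ℝ) : ℂ) • projRest n := by
    have h1 : (projRest n)ᴴ * ((n : ℂ) • 1 - numOp n) * projRest n =
        (n : ℂ) • projRest n - (numOp n - projW n) := by
      rw [hE, Matrix.mul_sub, Matrix.sub_mul, Matrix.mul_smul, Matrix.mul_one, Matrix.smul_mul,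
        hEE]
      congr 1
      simp only [projRest, Matrix.mul_sub, Matrix.sub_mul, Matrix.mul_one, Matrix.one_mul,
        projW_mul_numOp, projZero_mul_numOp, numOp_mul_projW, numOp_mul_projZero,
        projW_mul_self hn, projW_mul_projZero]
      simp
    rw [h1, HWham_eq]
    have h2 : (1 : QOp n) = projRest n + projW n + projZero n := by rw [projRest]; abel
    rw [h2]
    push_cast
    module
  rw [key]
  refine ((PosSemidef.smul (HW0_sub_posSemidef hn hlam) (by simpa using hΓ0)).add
    (PosSemidef.conjTranspose_mul_mul_same ?_ _)).add
    (PosSemidef.smul (posSemidef_of_isIdempotent hE hEE) ?_)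
  · have h3 : (n : ℂ) • (1 : QOp n) - numOp n =
        diagonal fun x : QIdx n => (n : ℂ) - ((∑ i, (x i : ℕ) : ℕ) : ℂ) := by
      rw [numOp_eq_diagonal, ← diagonal_one, ← diagonal_smul, diagonal_sub]
      congr 1
      ext x
      simp
    rw [h3, posSemidef_diagonal_iff]
    intro x
    have h4 : ∑ i, (x i : ℕ) ≤ n := by
      rw [sum_eq_card_filter]
      exact (Finset.card_le_univ _).trans_eq (Fintype.card_fin n)
    rw [sub_nonneg]
    exact_mod_cast h4
  · rw [Complex.zero_le_real]; linarith

lemma HWham_mulVec_Wstate (Γ : ℝ) : HWham n Γ *ᵥ Wstate n = 0 := by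
  rw [HWham_eq, sub_mulVec, add_mulVec, smul_mulVec, HW0_mulVec_Wstate, numOp_mulVec_Wstate]
  simp

lemma HWham_mulVec_ket0 (Γ : ℝ) : HWham n Γ *ᵥ ket0 n = ket0 n := by
  rw [HWham_eq, sub_mulVec, add_mulVec, smul_mulVec, HW0_mulVec_ket0, numOp_mulVec_ket0]
  simp

lemma HWham_posSemidef (hn : n ≠ 0) {lam Γ : ℝ} (hl : 0 < lam)
    (hlam : ∀ μ : ℝ, (μ : ℂ) ∈ spectrum ℂ (HW0 n) → μ ≠ 0 → lam ≤ μ)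
    (hΓ : 5 * (n : ℝ) < Γ * lam + 1) : (HWham n Γ).PosSemidef := by
  have h1 := ((HWham_sub_posSemidef hn hl hlam hΓ).add
    (posSemidef_of_isIdempotent projZero_conjTranspose projZero_mul_self)).add
    (PosSemidef.smul (posSemidef_of_isIdempotent projRest_conjTranspose (projRest_mul_self hn))
      (a := ((4 * n : ℝ) : ℂ)) (by rw [Complex.zero_le_real]; positivity))
  simpa using h1

/-- Bounds on the Green's function of the W-state Hamiltonian. -/
lemma norm_green_le (hn : n ≠ 0) {lam Γ : ℝ} (hl : 0 < lam)
    (hlam : ∀ μ : ℝ, (μ : ℂ) ∈ spectrum ℂ (HW0 n) → μ ≠ 0 → lam ≤ μ)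
    (hΓ : 5 * (n : ℝ) < Γ * lam + 1) {G : QOp n} (hG : Gᴴ = G)
    (hGH : G * HWham n Γ = 1 - projW n) (hGW : G *ᵥ Wstate n = 0) :
    ‖G‖ ≤ 1 ∧ ‖G - projZero n‖ ≤ (4 * n : ℝ)⁻¹ := by
  have hn1 : (1 : ℝ) ≤ n := by exact_mod_cast Nat.one_le_iff_ne_zero.2 hn
  have hpsd := HWham_sub_posSemidef hn hl hlam hΓ
  have hE := posSemidef_of_isIdempotent projRest_conjTranspose (projRest_mul_self hn)
  have hGp : G * projW n = 0 := by rw [projW_eq, mul_vecMulVec, hGW, zero_vecMulVec]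
  have hpG : projW n * G = 0 := by
    have := congrArg conjTranspose hGp
    rwa [conjTranspose_mul, hG, projW_conjTranspose, conjTranspose_zero] at this
  have hGz : G * projZero n = projZero n := by
    have h1 : HWham n Γ * projZero n = projZero n := by
      rw [projZero, mul_vecMulVec, HWham_mulVec_ket0]
    calc G * projZero n = G * HWham n Γ * projZero n := by rw [Matrix.mul_assoc, h1]
      _ = projZero n := by rw [hGH, Matrix.sub_mul, projW_mul_projZero]; simp
  have hzG : projZero n * G = projZero n := by
    have := congrArg conjTranspose hGz
    rwa [conjTranspose_mul, hG, projZero_conjTranspose] at this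
  have hGHG : G * HWham n Γ * G = G := by
    rw [hGH, Matrix.sub_mul, hpG]; simp
  have hGEG : G * projRest n * G = G * G - projZero n := by
    simp only [projRest, Matrix.mul_sub, Matrix.sub_mul, Matrix.mul_one, hGp, hGz, hzG]
    simp
  have hc := hpsd.conjTranspose_mul_mul_same G
  rw [hG, Matrix.mul_sub, Matrix.mul_sub, Matrix.sub_mul, Matrix.sub_mul, hGHG, hGz, hzG,
    Matrix.mul_smul, Matrix.smul_mul, hGEG] at hc
  constructor
  · have := norm_le_inv_of_posSemidef hG one_pos (by
      have h1 := hc.add ((PosSemidef.conjTranspose_mul_mul_same hE G).smul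
        (a := ((4 * n - 1 : ℝ) : ℂ)) (by rw [Complex.zero_le_real]; linarith))
      rw [hG, hGEG] at h1
      convert h1 using 1
      push_cast
      module)
    simpa using this
  · refine norm_le_inv_of_posSemidef ?_ (by positivity) ?_
    · simp [IsHermitian, hG, projZero_conjTranspose]
    · convert hc using 1
      have h2 : (G - projZero n) * (G - projZero n) = G * G - projZero n := by
        simp only [Matrix.mul_sub, Matrix.sub_mul, hGz, hzG, projZero_mul_self]
        abel
      rw [h2]
      abel

end Green

end QSim

namespace QSim

open scoped Matrix.Norms.L2Operator

section Kronecker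

variable {I J : Type*} [Fintype I] [DecidableEq I]

lemma prodIso_mul_conjTranspose_prodIso (w u : J → ℂ) :
    (prodIso w : Matrix (I × J) I ℂ) * (prodIso u : Matrix (I × J) I ℂ)ᴴ =
      (1 : Matrix I I ℂ) ⊗ₖ vecMulVec w (star u) := by
  ext ⟨a, b⟩ ⟨c, d⟩
  simp only [Matrix.mul_apply, prodIso, conjTranspose_apply, kroneckerMap_apply,
    Matrix.one_apply, vecMulVec_apply]
  rw [Finset.sum_eq_single a] <;> simp +contextual [eq_comm, apply_ite]

variable [Fintype J]

lemma kronecker_mul_prodIso (A : Matrix I I ℂ) (B : Matrix J J ℂ) (w : J → ℂ) :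
    (A ⊗ₖ B) * (prodIso w : Matrix (I × J) I ℂ) =
      (prodIso (B *ᵥ w) : Matrix (I × J) I ℂ) * A := by
  ext ⟨a, b⟩ i
  simp only [Matrix.mul_apply, prodIso, kroneckerMap_apply, Fintype.sum_prod_type, mul_ite,
    mul_zero, ite_mul, zero_mul, mulVec, dotProduct]
  rw [Finset.sum_comm]
  simp [Finset.mul_sum, mul_comm, mul_left_comm]

lemma conjTranspose_prodIso_mul_prodIso (w u : J → ℂ) :
    (prodIso w : Matrix (I × J) I ℂ)ᴴ * (prodIso u : Matrix (I × J) I ℂ) =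
      (star w ⬝ᵥ u) • (1 : Matrix I I ℂ) := by
  ext a c
  simp only [Matrix.mul_apply, prodIso, conjTranspose_apply, Fintype.sum_prod_type,
    Matrix.smul_apply, Matrix.one_apply, dotProduct]
  by_cases h : a = c
  · subst h
    rw [Finset.sum_eq_single a] <;> simp +contextual
  · rw [Finset.sum_eq_single a] <;> simp +contextual [h]

lemma conjTranspose_prodIso_mul_kronecker_mul_prodIso (A : Matrix I I ℂ) (B : Matrix J J ℂ)
    (w : J → ℂ) :
    (prodIso w : Matrix (I × J) I ℂ)ᴴ * (A ⊗ₖ B) * (prodIso w : Matrix (I × J) I ℂ) =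
      (star w ⬝ᵥ B *ᵥ w) • A := by
  rw [Matrix.mul_assoc, kronecker_mul_prodIso, ← Matrix.mul_assoc,
    conjTranspose_prodIso_mul_prodIso, Matrix.smul_mul, Matrix.one_mul]

variable [DecidableEq J]

lemma norm_kronecker_one_le {A : Matrix I I ℂ} (hA : A.IsHermitian) :
    ‖A ⊗ₖ (1 : Matrix J J ℂ)‖ ≤ ‖A‖ := by
  set U : Matrix I I ℂ := (hA.eigenvectorUnitary : Matrix I I ℂ) with hU
  have hUU : Uᴴ * U = 1 := eigenvectorUnitary_conjTranspose_mul hA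
  have hV : ‖U ⊗ₖ (1 : Matrix J J ℂ)‖ ≤ 1 := by
    refine norm_le_one_of_conjTranspose_mul_self ?_
    rw [conjTranspose_kronecker, ← mul_kronecker_mul, hUU]
    simp
  have e : A ⊗ₖ (1 : Matrix J J ℂ) = (U ⊗ₖ (1 : Matrix J J ℂ)) *
      diagonal (fun p : I × J => (hA.eigenvalues p.1 : ℂ)) * (U ⊗ₖ (1 : Matrix J J ℂ))ᴴ := by
    have hd : diagonal (fun p : I × J => (hA.eigenvalues p.1 : ℂ)) =
        diagonal (fun k => (hA.eigenvalues k : ℂ)) ⊗ₖ (1 : Matrix J J ℂ) := by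
      rw [← diagonal_one, diagonal_kronecker_diagonal]
      simp
    rw [hd, conjTranspose_kronecker, ← mul_kronecker_mul, ← mul_kronecker_mul]
    simp only [conjTranspose_one, Matrix.mul_one]
    congr 1
    exact (specFn_eigenvalues hA).symm
  have hD : ‖diagonal (fun p : I × J => (hA.eigenvalues p.1 : ℂ))‖ ≤ ‖A‖ := by
    rw [l2_opNorm_diagonal]
    refine (pi_norm_le_iff_of_nonneg (norm_nonneg _)).2 fun p => ?_
    have := norm_apply_le_norm_specFn hA (fun k => (hA.eigenvalues k : ℂ)) p.1
    rwa [specFn_eigenvalues] at this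
  rw [e]
  have := norm_mul_le_of_le (norm_mul_le_of_le hV hD)
    ((l2_opNorm_conjTranspose (U ⊗ₖ (1 : Matrix J J ℂ))).trans_le hV)
  simpa using this

lemma norm_one_kronecker_le_one {G : Matrix J J ℂ} (hG : G.PosSemidef) (hn : ‖G‖ ≤ 1) :
    ‖(1 : Matrix I I ℂ) ⊗ₖ G‖ ≤ 1 := by
  have hH := hG.isHermitian
  have h1 : (G - G * G).PosSemidef := by
    have e : G - G * G = specFn hH (fun k => (hH.eigenvalues k : ℂ) -
        (hH.eigenvalues k : ℂ) * hH.eigenvalues k) := by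
      rw [specFn_sub, ← specFn_mul, specFn_eigenvalues]
    rw [e, posSemidef_specFn_iff]
    intro k
    have hk := norm_apply_le_norm_specFn hH (fun k => (hH.eigenvalues k : ℂ)) k
    rw [specFn_eigenvalues, Complex.norm_real, Real.norm_eq_abs] at hk
    have h2 := (abs_le.1 (hk.trans hn)).2
    have h3 := hG.eigenvalues_nonneg k
    rw [← Complex.ofReal_mul, ← Complex.ofReal_sub, Complex.zero_le_real]
    nlinarith
  have h2 : ((1 : Matrix I I ℂ) ⊗ₖ G).IsHermitian := by
    rw [IsHermitian, conjTranspose_kronecker, conjTranspose_one, hH]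
  have := norm_le_inv_of_posSemidef h2 one_pos (by
    have h3 := (PosSemidef.one (n := I) (R := ℂ)).kronecker h1
    have e : (1 : Matrix I I ℂ) ⊗ₖ (G - G * G) =
        1 ⊗ₖ G - ((1 : ℝ) : ℂ) • ((1 ⊗ₖ G) * (1 ⊗ₖ G)) := by
      rw [← mul_kronecker_mul, Complex.ofReal_one, one_smul, Matrix.one_mul]
      ext p q
      simp [mul_sub]
    rw [e] at h3
    exact h3)
  simpa using this

lemma norm_dotProduct_mulVec_le (A : Matrix J J ℂ) {w : J → ℂ} (hw : star w ⬝ᵥ w = 1) :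
    ‖star w ⬝ᵥ A *ᵥ w‖ ≤ ‖A‖ := by
  have hw1 : ‖(WithLp.toLp 2 w : EuclideanSpace ℂ J)‖ = 1 := by
    have h1 : inner ℂ (WithLp.toLp 2 w : EuclideanSpace ℂ J) (WithLp.toLp 2 w) = 1 := by
      rw [EuclideanSpace.inner_toLp_toLp, dotProduct_comm, hw]
    rw [inner_self_eq_norm_sq_to_K] at h1
    have h2 : ‖(WithLp.toLp 2 w : EuclideanSpace ℂ J)‖ ^ 2 = 1 := by
      apply Complex.ofReal_injective
      push_cast
      exact h1
    nlinarith [norm_nonneg (WithLp.toLp 2 w : EuclideanSpace ℂ J)]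
  have h3 := norm_inner_le_norm (𝕜 := ℂ) (WithLp.toLp 2 w : EuclideanSpace ℂ J)
    (WithLp.toLp 2 (A *ᵥ w))
  rw [EuclideanSpace.inner_toLp_toLp, dotProduct_comm, hw1, one_mul] at h3
  have h4 := l2_opNorm_mulVec A (WithLp.toLp 2 w : EuclideanSpace ℂ J)
  rw [hw1, mul_one] at h4
  exact h3.trans h4

end Kronecker

end QSim

namespace QSim

open scoped Matrix.Norms.L2Operator

section Correlations

variable {n : ℕ}

lemma Xop_mulVec (i : Fin n) (v : QIdx n → ℂ) (x : QIdx n) :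
    (Xop n i *ᵥ v) x = v (Function.update x i (1 + x i)) := by
  rw [Xop, oneQubitOp_mulVec]
  generalize x i = a
  fin_cases a <;> simp [Xmat]

lemma Xop_mulVec_Wstate_zero (i : Fin n) :
    (Xop n i *ᵥ Wstate n) 0 = (((√n)⁻¹ : ℝ) : ℂ) := by
  rw [Xop_mulVec, ← Wstate_singleIdx i]
  simp [singleIdx, Pi.single]

lemma star_expectW (M : QOp n) : star (expectW n M) = expectW n Mᴴ := by
  rw [expectW, expectW, star_dotProduct, star_mulVec, dotProduct_mulVec, star_star]

lemma expectW_Xop (i : Fin n) : expectW n (Xop n i) = 0 := by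
  rw [expectW, star_Wstate, Wstate_dotProduct, Finset.sum_eq_zero, mul_zero]
  intro k _
  rw [Xop_mulVec]
  refine Wstate_of_ne fun l hl => ?_
  by_cases hk : k = i
  · subst hk
    have := congrFun hl l
    by_cases h : l = k
    · subst h; simp [singleIdx] at this
    · simp [singleIdx, h] at this
  · have h1 := congrFun hl k
    have h2 := congrFun hl i
    by_cases h : k = l
    · subst h; simp [singleIdx, Ne.symm hk] at h2
    · simp [singleIdx, hk, h] at h1

lemma expectW_Xop_projZero_Xop (i j : Fin n) :
    expectW n (Xop n i * projZero n * Xop n j) = (n : ℂ)⁻¹ := by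
  have h : star (Wstate n) ᵥ* Xop n i = star (Xop n i *ᵥ Wstate n) := by
    rw [star_mulVec, Xop_conjTranspose]
  rw [expectW, ← mulVec_mulVec, ← mulVec_mulVec, dotProduct_mulVec, h, projZero,
    vecMulVec_mulVec, ket0_dotProduct, Xop_mulVec_Wstate_zero, dotProduct_comm,
    op_smul_eq_smul, smul_dotProduct,
    ket0_dotProduct, Pi.star_apply, Xop_mulVec_Wstate_zero, smul_eq_mul,
    ← inv_sqrt_mul_inv_sqrt]
  simp

lemma norm_Xop_le (i : Fin n) : ‖Xop n i‖ ≤ 1 :=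
  norm_le_one_of_conjTranspose_mul_self (by rw [Xop_conjTranspose, Xop_mul_self])

lemma expectW_sub (M N : QOp n) : expectW n (M - N) = expectW n M - expectW n N := by
  rw [expectW, sub_mulVec, dotProduct_sub]; rfl

lemma norm_expectW_sub_le (hn : n ≠ 0) {G : QOp n} {t : ℝ} (hG : ‖G - projZero n‖ ≤ t)
    (i j : Fin n) : ‖expectW n (Xop n i * G * Xop n j) - (n : ℂ)⁻¹‖ ≤ t := by
  rw [← expectW_Xop_projZero_Xop i j, ← expectW_sub, ← Matrix.sub_mul, ← Matrix.mul_sub]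
  refine (norm_dotProduct_mulVec_le _ ?_).trans ?_
  · rw [star_Wstate, Wstate_dotProduct_self hn]
  · simpa using norm_mul_le_of_le (norm_mul_le_of_le (norm_Xop_le i) hG) (norm_Xop_le j)

/-- The coupling constants of the gadget are real, and of order `1/n`. -/
lemma exists_coupling_constants (hn : n ≠ 0) {G : QOp n} (hG : Gᴴ = G)
    (hGn : ‖G - projZero n‖ ≤ (4 * n : ℝ)⁻¹) (i j : Fin n) :
    ∃ c di dj : ℝ, 0 < c ∧ (n : ℝ)⁻¹ ≤ c ∧ |c⁻¹ * (di + dj)| ≤ 2 ∧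
      expectW n (Xop n i * G * Xop n i) = di ∧ expectW n (Xop n j * G * Xop n j) = dj ∧
      expectW n (Xop n i * G * Xop n j) + expectW n (Xop n j * G * Xop n i) = c := by
  have hn1 : (1 : ℝ) ≤ n := by exact_mod_cast Nat.one_le_iff_ne_zero.2 hn
  have hstar : ∀ k l, star (expectW n (Xop n k * G * Xop n l)) =
      expectW n (Xop n l * G * Xop n k) := by
    intro k l
    rw [star_expectW, conjTranspose_mul, conjTranspose_mul, hG, Xop_conjTranspose,
      Xop_conjTranspose, Matrix.mul_assoc]
  have hre : ∀ k l, |(expectW n (Xop n k * G * Xop n l)).re - (n : ℝ)⁻¹| ≤ (4 * n : ℝ)⁻¹ := by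
    intro k l
    have h1 := (Complex.abs_re_le_norm _).trans (norm_expectW_sub_le hn hGn k l)
    rwa [Complex.sub_re, ← Complex.ofReal_natCast, ← Complex.ofReal_inv, Complex.ofReal_re] at h1
  have hreal : ∀ k, expectW n (Xop n k * G * Xop n k) =
      ((expectW n (Xop n k * G * Xop n k)).re : ℂ) := fun k =>
    (Complex.conj_eq_iff_re.1 (hstar k k)).symm
  have hC : expectW n (Xop n i * G * Xop n j) + expectW n (Xop n j * G * Xop n i) =
      ((2 * (expectW n (Xop n i * G * Xop n j)).re : ℝ) : ℂ) := by
    rw [← hstar i j]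
    exact Complex.add_conj _
  have h4 : (4 * n : ℝ)⁻¹ = (n : ℝ)⁻¹ / 4 := by rw [mul_inv]; ring
  have hi := abs_le.1 (hre i i)
  have hj := abs_le.1 (hre j j)
  have hij := abs_le.1 (hre i j)
  rw [h4] at hi hj hij
  have hpos : 0 < (n : ℝ)⁻¹ := by positivity
  refine ⟨_, _, _, ?_, ?_, ?_, hreal i, hreal j, hC⟩
  · linarith
  · linarith
  · rw [abs_mul, abs_inv, inv_mul_le_iff₀ (by rw [abs_pos]; linarith), abs_of_pos
      (a := 2 * (expectW n (Xop n i * G * Xop n j)).re) (by linarith), abs_le]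
    constructor <;> linarith

end Correlations

end QSim

namespace QSim

section Gadget
open scoped Matrix.Norms.L2Operator

variable {n m : ℕ}

/-- The effective interaction at second order. -/
lemma conjTranspose_prodIso_mul_interaction {PA PB : QOp m} {Xi Xj G : QOp n} (κ : ℂ)
    (hcomm : PA * PB = PB * PA) :
    (prodIso (Wstate n) : Matrix (QIdx m × QIdx n) (QIdx m) ℂ)ᴴ *
      ((κ • (PA ⊗ₖ Xi - PB ⊗ₖ Xj)) * ((1 : QOp m) ⊗ₖ G) * (κ • (PA ⊗ₖ Xi - PB ⊗ₖ Xj))) *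
      (prodIso (Wstate n) : Matrix (QIdx m × QIdx n) (QIdx m) ℂ) =
    (κ * κ) • (expectW n (Xi * G * Xi) • (PA * PA) + expectW n (Xj * G * Xj) • (PB * PB) -
      (expectW n (Xi * G * Xj) + expectW n (Xj * G * Xi)) • (PA * PB)) := by
  have h : (κ • (PA ⊗ₖ Xi - PB ⊗ₖ Xj)) * ((1 : QOp m) ⊗ₖ G) * (κ • (PA ⊗ₖ Xi - PB ⊗ₖ Xj)) =
      (κ * κ) • ((PA * PA) ⊗ₖ (Xi * G * Xi) + (PB * PB) ⊗ₖ (Xj * G * Xj) -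
        ((PA * PB) ⊗ₖ (Xi * G * Xj) + (PB * PA) ⊗ₖ (Xj * G * Xi))) := by
    simp only [Matrix.smul_mul, Matrix.mul_smul, Matrix.mul_sub, Matrix.sub_mul,
      ← mul_kronecker_mul, Matrix.mul_one]
    module
  rw [h, ← hcomm]
  simp only [Matrix.mul_smul, Matrix.smul_mul, Matrix.mul_sub, Matrix.sub_mul, Matrix.mul_add,
    Matrix.add_mul, conjTranspose_prodIso_mul_kronecker_mul_prodIso, add_smul]
  rfl

end Gadget

end QSim

namespace QSim

/-- The long-range gadget: there is a universal constant `c₀ > 0` such that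
for Pauli (Hermitian involution) operators `P_A, P_B` on two distinguished qubits of a
register, the interaction strengths obey `‖H₁‖ ≤ ‖H_else‖ + 2n`, `‖H₂‖ ≤ 2√n`, and for all
`ε, η ∈ (0,1]` and `Δ ≥ c₀(Λ⁶/ε² + Λ²/η²)`, the Hamiltonian
`H̃ = Δ·(1⊗H_W) + H₁ + √Δ·H₂` is a `(Δ/2, η, ε)`-simulation of `H_else + P_A⊗P_B`
with product encoding and ancilla state `|W_n⟩`. -/
theorem long_range_gadget :
    ∃ c₀ : ℝ, 0 < c₀ ∧
    ∀ (m : ℕ) (A B : Fin m), A ≠ B →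
    ∀ (Helse : QOp m), Helseᴴ = Helse →
    ∀ (pA pB : Matrix (Fin 2) (Fin 2) ℂ),
      pAᴴ = pA → pBᴴ = pB → pA * pA = 1 → pB * pB = 1 →
    ∀ (n : ℕ), 2 ≤ n → ∀ (i j : Fin n), i ≠ j →
    ∀ (lam : ℝ), 0 < lam → (lam : ℂ) ∈ spectrum ℂ (HW0 n) →
      (∀ μ : ℝ, (μ : ℂ) ∈ spectrum ℂ (HW0 n) → μ ≠ 0 → lam ≤ μ) →
    ∀ (Γ : ℝ), 5 * (n : ℝ) < Γ * lam + 1 →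
    ∀ (G : QOp n), Gᴴ = G →
      G * HWham n Γ = 1 - projW n → HWham n Γ * G = 1 - projW n →
      G *ᵥ Wstate n = 0 →
    let PA : QOp m := oneQubitOp m A pA
    let PB : QOp m := oneQubitOp m B pB
    let di : ℂ := expectW n (Xop n i * G * Xop n i)
    let dj : ℂ := expectW n (Xop n j * G * Xop n j)
    let C : ℂ := expectW n (Xop n i * G * Xop n j) + expectW n (Xop n j * G * Xop n i)
    let H₁ : QOp m := Helse + C⁻¹ • (di • (PA * PA) + dj • (PB * PB))
    let H₂ : Matrix (QIdx m × QIdx n) (QIdx m × QIdx n) ℂ :=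
      (C ^ ((1 : ℂ) / 2))⁻¹ • (PA ⊗ₖ Xop n i - PB ⊗ₖ Xop n j)
    let Λ : ℝ := max (opNorm H₁) (max (opNorm H₂) 1)
    opNorm H₁ ≤ opNorm Helse + 2 * n ∧
    opNorm H₂ ≤ 2 * Real.sqrt n ∧
    ∀ ε η : ℝ, ε ∈ Set.Ioc (0 : ℝ) 1 → η ∈ Set.Ioc (0 : ℝ) 1 →
      ∀ Δ : ℝ, c₀ * (Λ ^ 6 / ε ^ 2 + Λ ^ 2 / η ^ 2) ≤ Δ →
        IsSimulation
          ((Δ : ℂ) • ((1 : QOp m) ⊗ₖ HWham n Γ) + H₁ ⊗ₖ (1 : QOp n)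
            + ((Real.sqrt Δ : ℝ) : ℂ) • H₂)
          (Helse + PA * PB) (Wstate n) (Δ / 2) η ε := by
  refine ⟨10 ^ 6, by norm_num, ?_⟩
  intro m A B hAB Helse hHelse pA pB hpA hpB hpA2 hpB2 n hn i j _ lam hl _ hlam Γ hΓ G hG hGH
    hHG hGW PA PB di dj C H₁ H₂ Λ
  have hn0 : n ≠ 0 := by omega
  have hPA : PAᴴ = PA := by rw [oneQubitOp_conjTranspose, hpA]
  have hPB : PBᴴ = PB := by rw [oneQubitOp_conjTranspose, hpB]
  have hPA2 : PA * PA = 1 := by rw [oneQubitOp_mul, hpA2, oneQubitOp_one]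
  have hPB2 : PB * PB = 1 := by rw [oneQubitOp_mul, hpB2, oneQubitOp_one]
  have hcomm : PA * PB = PB * PA := oneQubitOp_comm hAB pA pB
  obtain ⟨hG1, hg⟩ := norm_green_le hn0 hl hlam hΓ hG hGH hGW
  obtain ⟨c, ri, rj, hc, hcn, hcr, hdi, hdj, hC⟩ := exists_coupling_constants hn0 hG hg i j
  have hdi' : di = ri := hdi
  have hdj' : dj = rj := hdj
  have hC' : C = c := hC
  have hκ : (C ^ ((1 : ℂ) / 2))⁻¹ = (((√c)⁻¹ : ℝ) : ℂ) := by
    rw [hC', Complex.ofReal_inv, Real.sqrt_eq_rpow, Complex.ofReal_cpow hc.le]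
    norm_num
  have hκκ : (((√c)⁻¹ : ℝ) : ℂ) * (((√c)⁻¹ : ℝ) : ℂ) = C⁻¹ := by
    rw [hC', ← Complex.ofReal_mul, ← mul_inv, Real.mul_self_sqrt hc.le, Complex.ofReal_inv]
  have hH₁ : H₁ = Helse + ((c⁻¹ * (ri + rj) : ℝ) : ℂ) • 1 := by
    simp only [H₁, hPA2, hPB2, hdi', hdj', hC']
    push_cast
    rw [← add_smul, smul_smul]
  have hH₂ : H₂ = (((√c)⁻¹ : ℝ) : ℂ) • (PA ⊗ₖ Xop n i - PB ⊗ₖ Xop n j) := by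
    simp only [H₂, hκ]
  have hH₁h : H₁ᴴ = H₁ := by
    rw [hH₁, conjTranspose_add, hHelse, conjTranspose_smul, conjTranspose_one]
    simp
  have hH₂h : H₂ᴴ = H₂ := by
    rw [hH₂, conjTranspose_smul, conjTranspose_sub, conjTranspose_kronecker,
      conjTranspose_kronecker, hPA, hPB, Xop_conjTranspose, Xop_conjTranspose]
    simp
  have hn1 : (2 : ℝ) ≤ n := by exact_mod_cast hn
  open scoped Matrix.Norms.L2Operator in
  have hb₁ : opNorm H₁ ≤ opNorm Helse + 2 * n := by
    change ‖H₁‖ ≤ ‖Helse‖ + 2 * n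
    rw [hH₁]
    refine (norm_add_le _ _).trans ?_
    gcongr
    rw [norm_smul, Complex.norm_real, Real.norm_eq_abs]
    have := norm_one_le (I := QIdx m)
    nlinarith [abs_nonneg (c⁻¹ * (ri + rj)), norm_nonneg (1 : QOp m)]
  open scoped Matrix.Norms.L2Operator in
  have hb₂ : opNorm H₂ ≤ 2 * √n := by
    change ‖H₂‖ ≤ 2 * √n
    have hinv : (√c)⁻¹ ≤ √n := by
      rw [← Real.sqrt_inv]
      refine Real.sqrt_le_sqrt ?_
      rw [inv_le_comm₀ hc (by positivity)]
      exact hcn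
    have hkron : ∀ (P : QOp m) (k : Fin n), Pᴴ = P → P * P = 1 → ‖P ⊗ₖ Xop n k‖ ≤ 1 := by
      intro P k hP hPP
      refine norm_le_one_of_conjTranspose_mul_self ?_
      rw [conjTranspose_kronecker, ← mul_kronecker_mul, hP, Xop_conjTranspose, hPP,
        Xop_mul_self]
      simp
    rw [hH₂, norm_smul, Complex.norm_real, Real.norm_eq_abs, abs_of_nonneg (by positivity),
      mul_comm]
    refine mul_le_mul ?_ hinv (by positivity) (by positivity)
    refine (norm_sub_le _ _).trans ?_
    linarith [hkron PA i hPA hPA2, hkron PB j hPB hPB2]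
  refine ⟨hb₁, hb₂, ?_⟩
  intro ε η hε hη Δ hΔ
  have hΛ1 : 1 ≤ Λ := (le_max_right _ _).trans (le_max_right _ _)
  have hΛ₁ : opNorm H₁ ≤ Λ := le_max_left _ _
  have hΛ₂ : opNorm H₂ ≤ Λ := (le_max_left _ _).trans (le_max_right _ _)
  clear_value Λ
  have hΔ1 : (1000 * Λ ^ 3 / ε) ^ 2 ≤ Δ := by
    have : 0 ≤ Λ ^ 2 / η ^ 2 := by positivity
    have e : (1000 * Λ ^ 3 / ε) ^ 2 = 10 ^ 6 * (Λ ^ 6 / ε ^ 2) := by ring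
    linarith
  have hΔ2 : (1000 * Λ / η) ^ 2 ≤ Δ := by
    have : 0 ≤ Λ ^ 6 / ε ^ 2 := by positivity
    have e : (1000 * Λ / η) ^ 2 = 10 ^ 6 * (Λ ^ 2 / η ^ 2) := by ring
    linarith
  have hs1 := Real.le_sqrt_of_sq_le hΔ1
  have hs2 := Real.le_sqrt_of_sq_le hΔ2
  have hsΔ : √Δ ^ 2 = Δ := Real.sq_sqrt ((sq_nonneg _).trans hΔ1)
  rw [div_le_iff₀ hε.1] at hs1
  rw [div_le_iff₀ hη.1] at hs2
  have hs : 1000 * Λ ≤ √Δ := by nlinarith [hη.2, Real.sqrt_nonneg Δ]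
  have hs0 : 0 < √Δ := by linarith
  have hWW : star (Wstate n) ⬝ᵥ Wstate n = 1 := by
    rw [star_Wstate, Wstate_dotProduct_self hn0]
  have hpsd := HWham_posSemidef hn0 hl hlam hΓ
  have hGpsd : G.PosSemidef := by
    have h1 := hpsd.conjTranspose_mul_mul_same G
    have h2 : projW n * G = 0 := by
      have := congrArg (fun v => vecMulVec (Wstate n) (star v)) hGW
      rw [star_mulVec, hG, star_Wstate] at this
      rw [projW_eq, vecMulVec_mul, this]
      simp
    rwa [hG, hGH, Matrix.sub_mul, h2, Matrix.one_mul, sub_zero] at h1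
  have hzero : (prodIso (0 : QIdx n → ℂ) : Matrix (QIdx m × QIdx n) (QIdx m) ℂ) = 0 := by
    ext; simp [prodIso]
  obtain ⟨Tt, h1, h2, h3, h4⟩ := exists_isometry_specProjBelow
    (T := (prodIso (Wstate n) : Matrix (QIdx m × QIdx n) (QIdx m) ℂ))
    (H₀ := (1 : QOp m) ⊗ₖ HWham n Γ) (G := (1 : QOp m) ⊗ₖ G) (H₁ := H₁ ⊗ₖ (1 : QOp n))
    (H₂ := H₂) (h₁ := H₁) (Λ := Λ) (s := √Δ)
    (by rw [conjTranspose_prodIso_mul_prodIso, hWW, one_smul])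
    (PosSemidef.one.kronecker hpsd)
    (by
      rw [← mul_kronecker_mul, hGH, prodIso_mul_conjTranspose_prodIso, star_Wstate, ← projW_eq,
        Matrix.one_mul, eq_sub_iff_add_eq, ← kronecker_add, sub_add_cancel, one_kronecker_one])
    (norm_one_kronecker_le_one hGpsd hG1)
    (by rw [kronecker_mul_prodIso, hGW, hzero, Matrix.zero_mul])
    (by rw [kronecker_mul_prodIso, HWham_mulVec_Wstate, hzero, Matrix.zero_mul])
    (by rw [conjTranspose_kronecker, hH₁h, conjTranspose_one])
    hH₂h
    (by rw [kronecker_mul_prodIso, one_mulVec])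
    (by
      rw [hH₂, Matrix.mul_smul, Matrix.smul_mul, Matrix.mul_sub, Matrix.sub_mul,
        conjTranspose_prodIso_mul_kronecker_mul_prodIso,
        conjTranspose_prodIso_mul_kronecker_mul_prodIso, ← expectW, ← expectW, expectW_Xop,
        expectW_Xop]
      simp)
    ((norm_kronecker_one_le hH₁h).trans hΛ₁) hΛ₁ hΛ₂ hΛ1 hs
    (H := (Δ : ℂ) • ((1 : QOp m) ⊗ₖ HWham n Γ) + H₁ ⊗ₖ (1 : QOp n)
            + ((√Δ : ℝ) : ℂ) • H₂) (by rw [hsΔ])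
  rw [hsΔ] at h2 h4
  have hC0 : C ≠ 0 := by rw [hC']; exact Complex.ofReal_ne_zero.2 hc.ne'
  have htarget : H₁ - (prodIso (Wstate n) : Matrix (QIdx m × QIdx n) (QIdx m) ℂ)ᴴ *
      (H₂ * ((1 : QOp m) ⊗ₖ G) * H₂) *
      (prodIso (Wstate n) : Matrix (QIdx m × QIdx n) (QIdx m) ℂ) = Helse + PA * PB := by
    rw [hH₂, conjTranspose_prodIso_mul_interaction _ hcomm, hκκ]
    change Helse + C⁻¹ • (di • (PA * PA) + dj • (PB * PB)) -
      C⁻¹ • (di • (PA * PA) + dj • (PB * PB) - C • (PA * PB)) = _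
    rw [smul_sub, smul_smul, inv_mul_cancel₀ hC0, one_smul]
    abel
  rw [htarget] at h4
  refine ⟨Tt, hWW, h1, h2, h3.trans ?_, h4.trans ?_⟩
  · rw [div_le_iff₀ hs0]; linarith
  · rw [div_le_iff₀ hs0]
    have : 0 ≤ Λ ^ 3 := by positivity
    linarith

end QSim
end

section
/- Let m ≥ 3 and let a, b, l be positive integers with a + b − l = m, ā := m − a ≥ 1, b̄ := m − b ≥ 1, and l ≥ 1. Let A = {1,…,a} and B = {m−b+1,…,m}, so A∪B = {1,…,m} and |A∩B| = l. Define λ₁ := √(a·b̄)/m − √(b̄/a), λ₂ := √(a·b)/m − l/√(a·b), λ₃ := √(ā·b)/m − √(ā/b), λ₄ := √(ā·b̄)/m, λ₅ := √(ā·b̄)/√(a·b), and set p := λ₂² + λ₃², q := λ₁² + λ₄², r := λ₁λ₂ + λ₃λ₄, u_± := ( (p+q) ± √((p−q)² + 4r²) )/2. Then the operator norm satisfies ‖Π_{A∪B} − Π_A·Π_B‖ = max( √(u_−), √(u_+), λ₅ ). -/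
open Matrix
open scoped Kronecker ComplexOrder

namespace QSim

/-- The orthogonal projector `Π_C = (|0…0⟩⟨0…0|_C + |W⟩⟨W|_C) ⊗ I_{Λ∖C}` onto the ground space
of `H_{W,0}` restricted to the qubits in `C`, written entrywise.  Here `|W⟩_C` is the
generalized W state on the qubits of `C` (with `⟨x|W⟩⟨W|y⟩ = 1/|C|` whenever `x` and `y` each
carry exactly one `1` inside `C`). -/
noncomputable def PiC (m : ℕ) (C : Finset (Fin m)) : QOp m := fun x y =>
  (if ∀ k ∉ C, x k = y k then 1 else 0) *
    ((if (∀ k ∈ C, x k = 0) ∧ (∀ k ∈ C, y k = 0) then 1 else 0) +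
      (if (C.filter fun k => x k = 1).card = 1 ∧ (C.filter fun k => y k = 1).card = 1
        then ((C.card : ℂ))⁻¹ else 0))

end QSim


namespace QSim

theorem norm_eq_of_orthonormal {𝕜 ι E F : Type*} [RCLike 𝕜] [Fintype ι] [Nonempty ι]
    [NormedAddCommGroup E] [InnerProductSpace 𝕜 E] [NormedAddCommGroup F] [InnerProductSpace 𝕜 F]
    {e : ι → E} {f : ι → F} (he : Orthonormal 𝕜 e) (hf : Orthonormal 𝕜 f) {c : ι → 𝕜} {s : ℝ}
    (hc : ∀ i, ‖c i‖ = s) (T : E →L[𝕜] F)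
    (hT : ∀ w, T w = ∑ i, (c i * inner 𝕜 (e i) w) • f i) : ‖T‖ = s := by
  obtain ⟨i₀⟩ := ‹Nonempty ι›
  have hs : 0 ≤ s := hc i₀ ▸ norm_nonneg _
  refine le_antisymm (T.opNorm_le_bound hs fun w ↦ ?_) ?_
  · refine le_of_sq_le_sq ?_ (by positivity)
    have h1 : ‖T w‖ ^ 2 = ∑ i, ‖c i * inner 𝕜 (e i) w‖ ^ 2 := by
      have := hf.inner_sum (fun i ↦ c i * inner 𝕜 (e i) w) (fun i ↦ c i * inner 𝕜 (e i) w)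
        Finset.univ
      rw [← hT, inner_self_eq_norm_sq_to_K] at this
      simp_rw [RCLike.conj_mul] at this
      exact_mod_cast this
    rw [h1]
    simp_rw [norm_mul, mul_pow, hc, ← Finset.mul_sum]
    gcongr
    exact he.sum_inner_products_le w
  · classical
    have h := T.le_opNorm (e i₀)
    have h2 : T (e i₀) = c i₀ • f i₀ := by
      rw [hT, Finset.sum_eq_single i₀]
      · simp [he.1 i₀, inner_self_eq_norm_sq_to_K]
      · intro j _ hj
        simp [he.2 hj]
      · simp
    rw [h2, norm_smul, hf.1, he.1, hc] at h
    simpa using h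

/-- The number of ones of `x` on the qubits in `C`. -/
def weight {m : ℕ} (C : Finset (Fin m)) (x : QIdx m) : ℕ := (C.filter fun k => x k = 1).card

theorem weight_union {m : ℕ} {C D : Finset (Fin m)} (h : Disjoint C D) (x : QIdx m) :
    weight (C ∪ D) x = weight C x + weight D x := by
  rw [weight, Finset.filter_union, Finset.card_union_of_disjoint]
  · rfl
  · exact Finset.disjoint_filter_filter h

theorem weight_add_weight_compl {m : ℕ} (C : Finset (Fin m)) (x : QIdx m) :
    weight C x + weight Cᶜ x = weight Finset.univ x := by
  rw [← weight_union disjoint_compl_right, Finset.union_compl]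

theorem weight_congr {m : ℕ} {C : Finset (Fin m)} {x y : QIdx m} (h : ∀ k ∈ C, x k = y k) :
    weight C x = weight C y :=
  congrArg Finset.card (Finset.filter_congr fun k hk ↦ by rw [h k hk])

theorem weight_eq_zero {m : ℕ} {C : Finset (Fin m)} {x : QIdx m} :
    weight C x = 0 ↔ ∀ k ∈ C, x k = 0 := by
  rw [weight, Finset.card_eq_zero, Finset.filter_eq_empty_iff]
  exact forall₂_congr fun k _ ↦ by omega

theorem PiC_apply {m : ℕ} (C : Finset (Fin m)) (x y : QIdx m) :
    PiC m C x y = if ∀ k ∉ C, x k = y k then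
      ((if weight C x = 0 ∧ weight C y = 0 then 1 else 0) +
        (if weight C x = 1 ∧ weight C y = 1 then (C.card : ℂ)⁻¹ else 0)) else 0 := by
  simp only [PiC, ← weight_eq_zero, ite_mul, one_mul, zero_mul]
  rfl

theorem card_weight_eq {m : ℕ} (S : Finset (Fin m)) (i j : ℕ) :
    (Finset.univ.filter fun x : QIdx m ↦ weight S x = i ∧ weight Sᶜ x = j).card =
      S.card.choose i * Sᶜ.card.choose j := by
  rw [← Finset.card_powersetCard, ← Finset.card_powersetCard, ← Finset.card_product]
  refine Finset.card_bij' (fun x _ ↦ (S.filter fun k ↦ x k = 1, Sᶜ.filter fun k ↦ x k = 1))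
    (fun p _ k ↦ if k ∈ p.1 ∪ p.2 then 1 else 0) (fun x hx ↦ ?_) (fun ⟨p, q⟩ h ↦ ?_)
    (fun x _ ↦ ?_) (fun ⟨p, q⟩ h ↦ ?_)
  · simpa [Finset.mem_powersetCard, weight] using (Finset.mem_filter.1 hx).2
  · simp only [Finset.mem_product, Finset.mem_powersetCard] at h
    obtain ⟨⟨hp, rfl⟩, hq, rfl⟩ := h
    rw [Finset.mem_filter]
    refine ⟨Finset.mem_univ _, congrArg Finset.card ?_, congrArg Finset.card ?_⟩ <;>
    · ext k
      have := @hp k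
      have := @hq k
      simp at this ⊢
      tauto
  · funext k
    have : x k = 0 ∨ x k = 1 := by omega
    rcases this with h | h <;> simp [h, em]
  · simp only [Finset.mem_product, Finset.mem_powersetCard] at h
    obtain ⟨⟨hp, rfl⟩, hq, rfl⟩ := h
    ext k
    all_goals
      have := @hp k
      have := @hq k
      simp at this ⊢
      tauto

theorem card_weight_eq_of_agree {m : ℕ} (L : Finset (Fin m)) (g : QIdx m) (t : ℕ) :
    (Finset.univ.filter fun z : QIdx m ↦ (∀ k ∉ L, z k = g k) ∧ weight L z = t).card =
      L.card.choose t := by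
  rw [← Finset.card_powersetCard]
  refine Finset.card_bij' (fun x _ ↦ L.filter fun k ↦ x k = 1)
    (fun p _ k ↦ if k ∈ L then (if k ∈ p then 1 else 0) else g k) (fun x hx ↦ ?_) (fun p h ↦ ?_)
    (fun x hx ↦ ?_) (fun p h ↦ ?_)
  · simpa [Finset.mem_powersetCard, weight] using (Finset.mem_filter.1 hx).2.2
  · obtain ⟨hp, rfl⟩ := Finset.mem_powersetCard.1 h
    rw [Finset.mem_filter]
    refine ⟨Finset.mem_univ _, fun k hk ↦ by simp [hk], congrArg Finset.card ?_⟩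
    ext k
    have := @hp k
    by_cases hk : k ∈ L <;> simp [hk]
    tauto
  · funext k
    by_cases hk : k ∈ L
    · have : x k = 0 ∨ x k = 1 := by omega
      rcases this with h | h <;> simp [h, hk]
    · simp [hk, (Finset.mem_filter.1 hx).2.1 k hk]
  · obtain ⟨hp, rfl⟩ := Finset.mem_powersetCard.1 h
    ext k
    have := @hp k
    by_cases hk : k ∈ L <;> simp [hk]
    tauto

theorem PiC_mul_apply {m : ℕ} {A B : Finset (Fin m)} (hAB : A ∪ B = Finset.univ) (x y : QIdx m) :
    (PiC m A * PiC m B) x y =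
      (if weight A x = weight Bᶜ y ∧ weight Aᶜ x = weight B y ∧ weight A x ≤ 1 ∧ weight B y ≤ 1 then
        (A.card : ℂ)⁻¹ ^ weight A x * (B.card : ℂ)⁻¹ ^ weight B y else 0) +
      (if weight A x = 1 ∧ weight B y = 1 ∧ weight Bᶜ y = 0 ∧ weight Aᶜ x = 0 then
        ((A ∩ B).card : ℂ) * ((A.card : ℂ)⁻¹ * (B.card : ℂ)⁻¹) else 0) := by
  set c₀ : ℂ := if weight A x = weight Bᶜ y ∧ weight Aᶜ x = weight B y ∧ weight A x ≤ 1 ∧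
    weight B y ≤ 1 then (A.card : ℂ)⁻¹ ^ weight A x * (B.card : ℂ)⁻¹ ^ weight B y else 0 with hc₀
  set c₁ : ℂ := if weight A x = 1 ∧ weight B y = 1 ∧ weight Bᶜ y = 0 ∧ weight Aᶜ x = 0 then
    (A.card : ℂ)⁻¹ * (B.card : ℂ)⁻¹ else 0 with hc₁
  set g : QIdx m := fun k ↦ if k ∈ A then y k else x k with hg
  have hmem (k : Fin m) : k ∈ A ∨ k ∈ B := by
    rw [← Finset.mem_union, hAB]; exact Finset.mem_univ k
  have hdecompA : A = Bᶜ ∪ (A ∩ B) := by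
    ext k; have := hmem k; simp; tauto
  have hdecompB : B = Aᶜ ∪ (A ∩ B) := by
    ext k; have := hmem k; simp; tauto
  have hdA : Disjoint Bᶜ (A ∩ B) := disjoint_compl_left.mono_right Finset.inter_subset_right
  have hdB : Disjoint Aᶜ (A ∩ B) := disjoint_compl_left.mono_right Finset.inter_subset_left
  have key (z : QIdx m) : PiC m A x z * PiC m B z y =
      (if (∀ k ∉ A ∩ B, z k = g k) ∧ weight (A ∩ B) z = 0 then c₀ else 0) +
      (if (∀ k ∉ A ∩ B, z k = g k) ∧ weight (A ∩ B) z = 1 then c₁ else 0) := by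
    have hagree : (∀ k ∉ A ∩ B, z k = g k) ↔ (∀ k ∉ A, x k = z k) ∧ ∀ k ∉ B, z k = y k := by
      constructor
      · intro h
        refine ⟨fun k hk ↦ ?_, fun k hk ↦ ?_⟩
        · rw [h k (by simp [hk])]; simp [hg, hk]
        · rw [h k (by simp [hk])]; simp [hg, (hmem k).resolve_right hk]
      · rintro ⟨h1, h2⟩ k hk
        by_cases hkA : k ∈ A
        · have hkB : k ∉ B := fun h ↦ hk (by simp [hkA, h])
          simp [hg, hkA, h2 k hkB]
        · simp [hg, hkA, h1 k hkA]
    rw [PiC_apply, PiC_apply]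
    by_cases h : (∀ k ∉ A, x k = z k) ∧ ∀ k ∉ B, z k = y k
    · have hzA : weight A z = weight Bᶜ y + weight (A ∩ B) z := by
        rw [← weight_congr (C := Bᶜ) (x := z) (y := y) (by simpa using h.2), ← weight_union hdA,
          ← hdecompA]
      have hzB : weight B z = weight Aᶜ x + weight (A ∩ B) z := by
        rw [weight_congr (C := Aᶜ) (x := x) (y := z) (by simpa using h.1), ← weight_union hdB,
          ← hdecompB]
      simp only [eq_true (hagree.2 h), true_and, if_pos h.1, if_pos h.2, hzA, hzB, hc₀, hc₁]
      generalize weight (A ∩ B) z = t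
      generalize weight A x = p
      generalize weight Aᶜ x = q
      generalize weight B y = r
      generalize weight Bᶜ y = u
      rcases p with _ | _ | p <;> rcases r with _ | _ | r <;> rcases t with _ | _ | t <;>
        rcases q with _ | _ | q <;> rcases u with _ | _ | u <;> simp
      omega
    · simp only [eq_false (mt hagree.1 h), false_and, if_false, add_zero]
      rcases not_and_or.1 h with h | h <;> simp [h]
  clear_value c₀ c₁
  rw [Matrix.mul_apply, Finset.sum_congr rfl fun z _ ↦ key z, Finset.sum_add_distrib,
    ← Finset.sum_filter, ← Finset.sum_filter, Finset.sum_const, Finset.sum_const,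
    card_weight_eq_of_agree, card_weight_eq_of_agree]
  simp [hc₁]

/-- The indicator of the basis states with `i` ones on `S` and `j` ones off `S`. -/
def sector {m : ℕ} (S : Finset (Fin m)) (i j : ℕ) : QIdx m → ℂ :=
  fun x ↦ if weight S x = i ∧ weight Sᶜ x = j then 1 else 0

/-- The one-excitation vector constant on `S` and on `Sᶜ` and orthogonal to the W state. -/
noncomputable def balanced {m : ℕ} (S : Finset (Fin m)) : QIdx m → ℂ :=
  ((Sᶜ.card : ℂ) / S.card) • sector S 1 0 - sector S 0 1

theorem PiC_univ_sub_mul_apply {m : ℕ} {A B : Finset (Fin m)} (hAB : A ∪ B = Finset.univ)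
    (hA : A.card ≠ 0) (hB : B.card ≠ 0) (x y : QIdx m) :
    (PiC m Finset.univ - PiC m A * PiC m B) x y =
      (m : ℂ)⁻¹ * balanced A x * balanced B y -
        ((A.card : ℂ) * B.card)⁻¹ * sector A 1 1 x * sector B 1 1 y := by
  have hA' : (A.card : ℂ) ≠ 0 := by exact_mod_cast hA
  have hB' : (B.card : ℂ) ≠ 0 := by exact_mod_cast hB
  have hAm : (A.card : ℂ) + Aᶜ.card = m := by
    exact_mod_cast (Finset.card_add_card_compl A).trans (Fintype.card_fin m)
  have hBm : (B.card : ℂ) + Bᶜ.card = m := by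
    exact_mod_cast (Finset.card_add_card_compl B).trans (Fintype.card_fin m)
  have hm : (m : ℂ) ≠ 0 := by
    have := A.card_le_univ
    simp at this
    exact_mod_cast (by omega : m ≠ 0)
  have hl : (A.card : ℂ) + B.card = m + (A ∩ B).card := by
    have := Finset.card_union_add_card_inter A B
    rw [hAB, Finset.card_univ, Fintype.card_fin] at this
    exact_mod_cast this.symm
  rw [Matrix.sub_apply, PiC_mul_apply hAB, PiC_apply, ← weight_add_weight_compl A x,
    ← weight_add_weight_compl B y]
  simp only [balanced, sector, Pi.sub_apply, Pi.smul_apply, smul_eq_mul, Finset.card_univ,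
    Fintype.card_fin, Finset.mem_univ, not_true_eq_false, false_imp_iff, implies_true, if_true]
  rw [show (Aᶜ.card : ℂ) = m - A.card by linear_combination hAm,
    show (Bᶜ.card : ℂ) = m - B.card by linear_combination hBm,
    show ((A ∩ B).card : ℂ) = A.card + B.card - m by linear_combination -hl]
  generalize weight A x = p
  generalize weight Aᶜ x = q
  generalize weight B y = r
  generalize weight Bᶜ y = u
  rcases p with _ | _ | p <;> rcases r with _ | _ | r <;> rcases q with _ | _ | q <;>
    rcases u with _ | _ | u <;> simp <;> (try omega) <;> field_simp <;> ring

theorem sector_dotProduct_sector {m : ℕ} (S : Finset (Fin m)) (i j i' j' : ℕ) :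
    sector S i j ⬝ᵥ sector S i' j' =
      if i = i' ∧ j = j' then (S.card.choose i : ℂ) * Sᶜ.card.choose j else 0 := by
  split_ifs with h
  · obtain ⟨rfl, rfl⟩ := h
    rw [← Nat.cast_mul, ← card_weight_eq, ← Finset.sum_boole]
    exact Finset.sum_congr rfl fun x _ ↦ by simp only [sector]; split_ifs <;> simp
  · refine Finset.sum_eq_zero fun x _ ↦ ?_
    simp only [sector]
    split_ifs <;> first | omega | simp

theorem balanced_dotProduct_balanced {m : ℕ} {S : Finset (Fin m)} (hS : S.card ≠ 0) :
    balanced S ⬝ᵥ balanced S = (Sᶜ.card : ℂ) * m / S.card := by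
  have hS' : (S.card : ℂ) ≠ 0 := by exact_mod_cast hS
  have hm : (S.card : ℂ) + Sᶜ.card = m := by
    exact_mod_cast (Finset.card_add_card_compl S).trans (Fintype.card_fin m)
  simp only [balanced, sub_dotProduct, dotProduct_sub, smul_dotProduct, dotProduct_smul,
    sector_dotProduct_sector]
  simp
  field_simp
  linear_combination (Sᶜ.card : ℂ) * hm

theorem sector_dotProduct_balanced {m : ℕ} (S : Finset (Fin m)) :
    sector S 1 1 ⬝ᵥ balanced S = 0 := by
  simp [balanced, dotProduct_sub, dotProduct_smul, sector_dotProduct_sector]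

theorem star_sector {m : ℕ} (S : Finset (Fin m)) (i j : ℕ) : star (sector S i j) = sector S i j := by
  funext x
  simp [sector, apply_ite]

theorem star_balanced {m : ℕ} (S : Finset (Fin m)) : star (balanced S) = balanced S := by
  simp [balanced, star_sector]

/-- Unit vectors along `balanced S` and `sector S 1 1`. -/
noncomputable def frame {m : ℕ} (S : Finset (Fin m)) : Fin 2 → QIdx m → ℂ :=
  ![(√(Sᶜ.card * m / S.card) : ℂ)⁻¹ • balanced S, (√(S.card * Sᶜ.card) : ℂ)⁻¹ • sector S 1 1]

theorem star_frame {m : ℕ} (S : Finset (Fin m)) (i : Fin 2) : star (frame S i) = frame S i := by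
  fin_cases i <;> simp [frame, star_balanced, star_sector]

theorem orthonormal_frame {m : ℕ} {S : Finset (Fin m)} (hS : S.card ≠ 0) (hS' : Sᶜ.card ≠ 0) :
    Orthonormal ℂ fun i ↦ WithLp.toLp 2 (frame S i) := by
  have hm : m ≠ 0 := by
    rintro rfl
    exact hS (by simp [Finset.eq_empty_of_isEmpty S])
  have hpos : (0 : ℝ) < Sᶜ.card * m / S.card := by positivity
  have hpos' : (0 : ℝ) < S.card * Sᶜ.card := by positivity
  have hsq : (√(Sᶜ.card * m / S.card) : ℂ) * √(Sᶜ.card * m / S.card) = Sᶜ.card * m / S.card := by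
    rw [← Complex.ofReal_mul, Real.mul_self_sqrt hpos.le]
    push_cast
    rfl
  have hsq' : (√(S.card * Sᶜ.card) : ℂ) * √(S.card * Sᶜ.card) = S.card * Sᶜ.card := by
    rw [← Complex.ofReal_mul, Real.mul_self_sqrt hpos'.le]
    push_cast
    rfl
  rw [orthonormal_iff_ite]
  intro i j
  rw [EuclideanSpace.inner_toLp_toLp, star_frame]
  fin_cases i <;> fin_cases j
  · simp only [frame, Fin.zero_eta, Matrix.cons_val_zero, smul_dotProduct, dotProduct_smul,
      balanced_dotProduct_balanced hS, smul_eq_mul, if_true]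
    rw [← mul_assoc, ← mul_inv, hsq]
    refine inv_mul_cancel₀ ?_
    simp only [ne_eq, div_eq_zero_iff, mul_eq_zero, Nat.cast_eq_zero]
    tauto
  · simp [frame, sector_dotProduct_balanced]
  · simp [frame, dotProduct_comm (balanced S), sector_dotProduct_balanced]
  · simp only [frame, Fin.mk_one, Matrix.cons_val_one, Matrix.cons_val_fin_one, smul_dotProduct,
      dotProduct_smul, sector_dotProduct_sector, smul_eq_mul, if_true, and_self, Nat.choose_one_right]
    rw [← mul_assoc, ← mul_inv, hsq']
    exact inv_mul_cancel₀ (by simp only [ne_eq, mul_eq_zero, Nat.cast_eq_zero]; tauto)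

theorem opNorm_eq_of_orthonormal {ι I J : Type*} [Fintype ι] [Nonempty ι] [Fintype I] [Fintype J]
    [DecidableEq J] {u : ι → I → ℂ} {v : ι → J → ℂ}
    (hu : Orthonormal ℂ fun i ↦ WithLp.toLp 2 (u i))
    (hv : Orthonormal ℂ fun i ↦ WithLp.toLp 2 (v i)) {c : ι → ℂ} {s : ℝ} (hc : ∀ i, ‖c i‖ = s)
    {M : Matrix I J ℂ} (hM : M = ∑ i, c i • vecMulVec (u i) (star (v i))) : opNorm M = s := by
  refine norm_eq_of_orthonormal hv hu hc _ fun w ↦ ?_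
  rw [LinearMap.coe_toContinuousLinearMap', Matrix.toLpLin_apply, hM, Matrix.sum_mulVec,
    WithLp.toLp_sum]
  refine Finset.sum_congr rfl fun i _ ↦ ?_
  rw [Matrix.smul_mulVec, Matrix.vecMulVec_mulVec, op_smul_eq_smul, smul_smul, WithLp.toLp_smul,
    ← WithLp.toLp_ofLp 2 w, EuclideanSpace.inner_toLp_toLp, dotProduct_comm]

theorem opNorm_PiC_univ_sub_mul {m : ℕ} {A B : Finset (Fin m)} (hAB : A ∪ B = Finset.univ)
    (hA : A.card ≠ 0) (hB : B.card ≠ 0) (hA' : Aᶜ.card ≠ 0) (hB' : Bᶜ.card ≠ 0) :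
    opNorm (PiC m Finset.univ - PiC m A * PiC m B) =
      √(Aᶜ.card * Bᶜ.card) / √(A.card * B.card) := by
  have hm : m ≠ 0 := by
    rintro rfl
    exact hA (by simp [Finset.eq_empty_of_isEmpty A])
  have hA0 : (0 : ℝ) < A.card := by positivity
  have hB0 : (0 : ℝ) < B.card := by positivity
  have hA0' : (0 : ℝ) < Aᶜ.card := by positivity
  have hB0' : (0 : ℝ) < Bᶜ.card := by positivity
  have hm0 : (0 : ℝ) < m := by positivity
  refine opNorm_eq_of_orthonormal (orthonormal_frame hA hA') (orthonormal_frame hB hB')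
    (c := ![((m : ℝ)⁻¹ * √(Aᶜ.card * m / A.card) * √(Bᶜ.card * m / B.card) : ℝ),
      (-((A.card * B.card : ℝ)⁻¹ * √(A.card * Aᶜ.card) * √(B.card * Bᶜ.card)) : ℝ)]) ?_ ?_
  · intro i
    fin_cases i
    · simp only [Fin.zero_eta, Matrix.cons_val_zero]
      rw [Complex.norm_of_nonneg (by positivity), mul_assoc, ← Real.sqrt_mul (by positivity),
        ← Real.sqrt_div (by positivity), inv_mul_eq_div, div_eq_iff hm0.ne',
        ← Real.sqrt_sq hm0.le, ← Real.sqrt_mul (by positivity), Real.sqrt_sq hm0.le]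
      congr 1
      field_simp
    · simp only [Fin.mk_one, Matrix.cons_val_one, Matrix.cons_val_fin_one]
      rw [Complex.norm_real, norm_neg, Real.norm_of_nonneg (by positivity)]
      have h1 := Real.sq_sqrt hA0.le
      have h2 := Real.sq_sqrt hB0.le
      rw [Real.sqrt_mul hA0.le, Real.sqrt_mul hB0.le, Real.sqrt_mul hA0.le, Real.sqrt_mul hA0'.le]
      field_simp
      rw [h1, h2]
  · have h1 : (√(Aᶜ.card * m / A.card) : ℂ) ≠ 0 := by
      exact_mod_cast (Real.sqrt_pos.2 (by positivity)).ne'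
    have h2 : (√(Bᶜ.card * m / B.card) : ℂ) ≠ 0 := by
      exact_mod_cast (Real.sqrt_pos.2 (by positivity)).ne'
    have h3 : (√(A.card * Aᶜ.card) : ℂ) ≠ 0 := by
      exact_mod_cast (Real.sqrt_pos.2 (by positivity)).ne'
    have h4 : (√(B.card * Bᶜ.card) : ℂ) ≠ 0 := by
      exact_mod_cast (Real.sqrt_pos.2 (by positivity)).ne'
    ext x y
    rw [PiC_univ_sub_mul_apply hAB hA hB]
    simp only [star_frame]
    simp only [Fin.sum_univ_two, Matrix.add_apply, Matrix.smul_apply,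
      Matrix.vecMulVec_apply, frame, Matrix.cons_val_zero, Matrix.cons_val_one,
      Matrix.cons_val_fin_one, Pi.smul_apply, smul_eq_mul]
    push_cast
    field_simp
    ring

theorem max_sqrt_eq {m a b l abar bbar : ℝ} (ha : 0 < a) (hb : 0 < b) (habar0 : 0 ≤ abar)
    (hbbar0 : 0 ≤ bbar) (habl : a + b = m + l) (habar : abar + a = m) (hbbar : bbar + b = m) :
    let l₁ : ℝ := √(a * bbar) / m - √(bbar / a)
    let l₂ : ℝ := √(a * b) / m - l / √(a * b)
    let l₃ : ℝ := √(abar * b) / m - √(abar / b)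
    let l₄ : ℝ := √(abar * bbar) / m
    let l₅ : ℝ := √(abar * bbar) / √(a * b)
    let p : ℝ := l₂ ^ 2 + l₃ ^ 2
    let q : ℝ := l₁ ^ 2 + l₄ ^ 2
    let r : ℝ := l₁ * l₂ + l₃ * l₄
    max (√(((p + q) - √((p - q) ^ 2 + 4 * r ^ 2)) / 2))
      (max (√(((p + q) + √((p - q) ^ 2 + 4 * r ^ 2)) / 2)) l₅) = l₅ := by
  intro l₁ l₂ l₃ l₄ l₅ p q r
  have hm : 0 < m := by linarith
  obtain ⟨x, hx, rfl⟩ : ∃ x, 0 < x ∧ a = x ^ 2 := ⟨√a, Real.sqrt_pos.2 ha, (Real.sq_sqrt ha.le).symm⟩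
  obtain ⟨y, hy, rfl⟩ : ∃ y, 0 < y ∧ b = y ^ 2 := ⟨√b, Real.sqrt_pos.2 hb, (Real.sq_sqrt hb.le).symm⟩
  obtain ⟨z, hz, rfl⟩ : ∃ z, 0 ≤ z ∧ abar = z ^ 2 :=
    ⟨√abar, Real.sqrt_nonneg _, (Real.sq_sqrt habar0).symm⟩
  obtain ⟨w, hw, rfl⟩ : ∃ w, 0 ≤ w ∧ bbar = w ^ 2 :=
    ⟨√bbar, Real.sqrt_nonneg _, (Real.sq_sqrt hbbar0).symm⟩
  have h₁ : l₁ = -(w * z ^ 2) / (m * x) := by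
    simp only [l₁, ← mul_pow, ← div_pow]
    rw [Real.sqrt_sq (by positivity), Real.sqrt_sq (by positivity)]
    field_simp
    linear_combination w * habar
  have h₂ : l₂ = z ^ 2 * w ^ 2 / (m * (x * y)) := by
    simp only [l₂, ← mul_pow]
    rw [Real.sqrt_sq (by positivity)]
    field_simp
    rw [show l = x ^ 2 + y ^ 2 - m by linarith, show z ^ 2 = m - x ^ 2 by linarith,
      show w ^ 2 = m - y ^ 2 by linarith]
    ring
  have h₃ : l₃ = -(z * w ^ 2) / (m * y) := by
    simp only [l₃, ← mul_pow, ← div_pow]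
    rw [Real.sqrt_sq (by positivity), Real.sqrt_sq (by positivity)]
    field_simp
    linear_combination z * hbbar
  have h₄ : l₄ = z * w / m := by
    simp only [l₄, ← mul_pow]
    rw [Real.sqrt_sq (by positivity)]
  have h₅ : l₅ = z * w / (x * y) := by
    simp only [l₅, ← mul_pow]
    rw [Real.sqrt_sq (by positivity), Real.sqrt_sq (by positivity)]
  have hp : p = l₅ ^ 2 * w ^ 2 / m := by
    simp only [p, h₂, h₃, h₅]
    field_simp
    linear_combination z ^ 2 * w ^ 4 * habar
  have hq : q = l₅ ^ 2 * y ^ 2 / m := by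
    simp only [q, h₁, h₄, h₅]
    field_simp
    linear_combination w ^ 2 * z ^ 2 * habar
  have hr : r = -(l₅ ^ 2 * (y * w) / m) := by
    simp only [r, h₁, h₂, h₃, h₄, h₅]
    field_simp
    linear_combination -w ^ 3 * z ^ 2 * habar
  have hl₅ : 0 ≤ l₅ := by positivity
  clear_value l₅ p q r
  have hpq : p + q = l₅ ^ 2 := by
    rw [hp, hq]
    field_simp
    linear_combination l₅ ^ 2 * hbbar
  have hdisc : (p - q) ^ 2 + 4 * r ^ 2 = (l₅ ^ 2) ^ 2 := by
    rw [← hpq, hp, hq, hr]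
    ring
  rw [hdisc, Real.sqrt_sq (by positivity), hpq, sub_self, zero_div, Real.sqrt_zero, add_self_div_two,
    Real.sqrt_sq hl₅, max_self, max_eq_right hl₅]

end QSim

namespace QSim

/-- Exact value of `‖Π_{A∪B} − Π_A·Π_B‖` for `A = {1,…,a}`,
`B = {m−b+1,…,m}` with `a + b − l = m`, `ā = m − a ≥ 1`, `b̄ = m − b ≥ 1`, `l ≥ 1`. -/
theorem PiC_overlap_norm_exact (m : ℕ) (hm : 3 ≤ m)
    (a b l abar bbar : ℕ) (ha0 : 0 < a) (hb0 : 0 < b) (hl : 1 ≤ l)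
    (habl : a + b = m + l) (habar : abar + a = m) (hbbar : bbar + b = m)
    (habar1 : 1 ≤ abar) (hbbar1 : 1 ≤ bbar)
    (A B : Finset (Fin m))
    (hA : A = Finset.univ.filter fun k : Fin m => k.1 < a)
    (hB : B = Finset.univ.filter fun k : Fin m => m - b ≤ k.1) :
    let l₁ : ℝ := Real.sqrt ((a : ℝ) * bbar) / m - Real.sqrt ((bbar : ℝ) / a)
    let l₂ : ℝ := Real.sqrt ((a : ℝ) * b) / m - (l : ℝ) / Real.sqrt ((a : ℝ) * b)
    let l₃ : ℝ := Real.sqrt ((abar : ℝ) * b) / m - Real.sqrt ((abar : ℝ) / b)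
    let l₄ : ℝ := Real.sqrt ((abar : ℝ) * bbar) / m
    let l₅ : ℝ := Real.sqrt ((abar : ℝ) * bbar) / Real.sqrt ((a : ℝ) * b)
    let p : ℝ := l₂ ^ 2 + l₃ ^ 2
    let q : ℝ := l₁ ^ 2 + l₄ ^ 2
    let r : ℝ := l₁ * l₂ + l₃ * l₄
    let um : ℝ := ((p + q) - Real.sqrt ((p - q) ^ 2 + 4 * r ^ 2)) / 2
    let up : ℝ := ((p + q) + Real.sqrt ((p - q) ^ 2 + 4 * r ^ 2)) / 2
    opNorm (PiC m (A ∪ B) - PiC m A * PiC m B)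
      = max (Real.sqrt um) (max (Real.sqrt up) l₅) := by
  intro l₁ l₂ l₃ l₄ l₅ p q r um up
  have hAc : A.card = a := by
    rw [hA, Fin.card_filter_val_lt, min_eq_right (by omega)]
  have hBc : B.card = b := by
    have h : Bᶜ = Finset.univ.filter fun k : Fin m ↦ k.1 < m - b := by
      ext k
      simp only [hB, Finset.mem_compl, Finset.mem_filter, Finset.mem_univ, true_and, not_le]
    have h2 := Finset.card_add_card_compl B
    rw [h, Fin.card_filter_val_lt, Fintype.card_fin] at h2
    omega
  have hAc' : Aᶜ.card = abar := by
    rw [Finset.card_compl, Fintype.card_fin]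
    omega
  have hBc' : Bᶜ.card = bbar := by
    rw [Finset.card_compl, Fintype.card_fin]
    omega
  have hAB : A ∪ B = Finset.univ := by
    ext k
    simp only [hA, hB, Finset.mem_union, Finset.mem_filter, Finset.mem_univ, true_and, iff_true]
    omega
  rw [hAB, opNorm_PiC_univ_sub_mul hAB (by omega) (by omega) (by omega) (by omega), hAc, hBc, hAc',
    hBc']
  exact (max_sqrt_eq (m := m) (l := l) (by exact_mod_cast ha0) (by exact_mod_cast hb0)
    (Nat.cast_nonneg _) (Nat.cast_nonneg _) (by exact_mod_cast habl) (by exact_mod_cast habar)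
    (by exact_mod_cast hbbar)).symm

end QSim
end
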